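/- Let T be a τ-tilting module over an artin algebra A that is not 1-tilting, and set I = Ann(T). Then I ⊗_A T = 0 but Tor₁^A(I, T) ≠ 0. -/

import Mathlib

open TensorProduct

section BalancedTensor

variable (R A : Type) [CommRing R] [Ring A] [Algebra R A]

/-- The relations defining the balanced tensor product over `A` inside `X ⊗[R] T`. -/
def balRel (X T : Type) [AddCommGroup X] [Module Aᵐᵒᵖ X] [Module R X]
    [AddCommGroup T] [Module A T] [Module R T] : Submodule R (X ⊗[R] T) :=
  Submodule.span R {z | ∃ (x : X) (a : A) (t : T),
    z = (MulOpposite.op a • x) ⊗ₜ[R] t - x ⊗ₜ[R] (a • t)}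

/-- The balanced tensor product `X ⊗[A] T` of a right `A`-module `X` and a
left `A`-module `T`. -/
def balTensor (X T : Type) [AddCommGroup X] [Module Aᵐᵒᵖ X] [Module R X]
    [AddCommGroup T] [Module A T] [Module R T] : Type :=
  (X ⊗[R] T) ⧸ balRel R A X T

noncomputable instance (X T : Type) [AddCommGroup X] [Module Aᵐᵒᵖ X] [Module R X]
    [AddCommGroup T] [Module A T] [Module R T] : AddCommGroup (balTensor R A X T) :=
  inferInstanceAs (AddCommGroup ((X ⊗[R] T) ⧸ balRel R A X T))

noncomputable instance (X T : Type) [AddCommGroup X] [Module Aᵐᵒᵖ X] [Module R X]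
    [AddCommGroup T] [Module A T] [Module R T] : Module R (balTensor R A X T) :=
  inferInstanceAs (Module R ((X ⊗[R] T) ⧸ balRel R A X T))

/-- Functoriality of the balanced tensor product in the second variable. -/
noncomputable def balMap (X : Type) [AddCommGroup X] [Module Aᵐᵒᵖ X] [Module R X]
    {T T' : Type} [AddCommGroup T] [Module A T] [Module R T] [IsScalarTower R A T]
    [AddCommGroup T'] [Module A T'] [Module R T'] [IsScalarTower R A T']
    (f : T →ₗ[A] T') : balTensor R A X T →ₗ[R] balTensor R A X T' :=
  Submodule.mapQ _ _ (TensorProduct.map LinearMap.id (f.restrictScalars R)) (by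
    rw [← Submodule.map_le_iff_le_comap, balRel, Submodule.map_span]
    apply Submodule.span_le.2
    rintro z ⟨w, ⟨x, a, t, rfl⟩, rfl⟩
    apply Submodule.subset_span
    exact ⟨x, a, f t, by simp [TensorProduct.map_tmul, map_smul]⟩)

/-- The kernel of the canonical free presentation `(T →₀ A) → T`. -/
noncomputable def presKer (T : Type) [AddCommGroup T] [Module A T] : Submodule A (T →₀ A) :=
  LinearMap.ker (Finsupp.linearCombination A (id : T → T))

/-- `Tor₁^A(X, T)`, computed from the canonical free presentation
`0 → K → (T →₀ A) → T → 0` of `T` as the kernel of `X ⊗[A] K → X ⊗[A] (T →₀ A)`. -/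
noncomputable def Tor1 (X T : Type) [AddCommGroup X] [Module Aᵐᵒᵖ X] [Module R X]
    [AddCommGroup T] [Module A T] [Module R T] [IsScalarTower R A T] : Type :=
  ↥(LinearMap.ker (balMap R A X (T := ↥(presKer A T)) (T' := (T →₀ A))
      ((presKer A T).subtype)))

noncomputable instance (X T : Type) [AddCommGroup X] [Module Aᵐᵒᵖ X] [Module R X]
    [AddCommGroup T] [Module A T] [Module R T] [IsScalarTower R A T] :
    AddCommGroup (Tor1 R A X T) :=
  inferInstanceAs (AddCommGroup ↥(LinearMap.ker (balMap R A X (T := ↥(presKer A T))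
    (T' := (T →₀ A)) ((presKer A T).subtype))))

noncomputable instance (X T : Type) [AddCommGroup X] [Module Aᵐᵒᵖ X] [Module R X]
    [AddCommGroup T] [Module A T] [Module R T] [IsScalarTower R A T] :
    Module R (Tor1 R A X T) :=
  inferInstanceAs (Module R ↥(LinearMap.ker (balMap R A X (T := ↥(presKer A T))
    (T' := (T →₀ A)) ((presKer A T).subtype))))

/-- A two-sided ideal regarded as a right submodule of `A`. -/
def rIdeal (I : TwoSidedIdeal A) : Submodule Aᵐᵒᵖ A where
  carrier := I
  add_mem' := I.add_mem
  zero_mem' := I.zero_mem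
  smul_mem' := fun a x hx => by simpa using I.mul_mem_right x a.unop hx

instance : IsScalarTower R Aᵐᵒᵖ A :=
  ⟨fun r a x => by
    show x * (r • a).unop = r • (x * a.unop)
    simp [mul_smul_comm]⟩

end BalancedTensor

/-- The `n`-th Ext-group `Ext_A^n(M, N)` of left `A`-modules. -/
noncomputable def egrp (A : Type) [Ring A] (n : ℕ) (M N : Type) [AddCommGroup M] [Module A M]
    [AddCommGroup N] [Module A N] : Type :=
  ((_root_.Ext ℤ (ModuleCat A) n).obj (Opposite.op (ModuleCat.of A M))).obj
    (ModuleCat.of A N)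

noncomputable instance (A : Type) [Ring A] (n : ℕ) (M N : Type) [AddCommGroup M] [Module A M]
    [AddCommGroup N] [Module A N] : AddCommGroup (egrp A n M N) :=
  inferInstanceAs (AddCommGroup (((_root_.Ext ℤ (ModuleCat A) n).obj
    (Opposite.op (ModuleCat.of A M))).obj (ModuleCat.of A N)))

section Count

variable (B : Type) [Ring B]

/-- `M` is an indecomposable module. -/
def isIndec (M : Type) [AddCommGroup M] [Module B M] : Prop :=
  Nontrivial M ∧ ∀ (X Y : Type) [AddCommGroup X] [Module B X] [AddCommGroup Y] [Module B Y],
    Nonempty (M ≃ₗ[B] X × Y) → Subsingleton X ∨ Subsingleton Y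

/-- The setoid identifying isomorphic modules satisfying a given predicate. -/
def isoSetoid (pred : ModuleCat B → Prop) : Setoid {N : ModuleCat B // pred N} where
  r X Y := Nonempty (↥X.1 ≃ₗ[B] ↥Y.1)
  iseqv := ⟨fun _ => ⟨LinearEquiv.refl B _⟩, fun ⟨e⟩ => ⟨e.symm⟩, fun ⟨e⟩ ⟨f⟩ => ⟨e.trans f⟩⟩

/-- `|M|`: the number of isomorphism classes of indecomposable direct summands of `M`. -/
noncomputable def numIndec (M : Type) [AddCommGroup M] [Module B M] : ℕ :=
  Nat.card (Quotient (isoSetoid B (fun N => isIndec B ↥N ∧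
    ∃ (s : ↥N →ₗ[B] M) (r : M →ₗ[B] ↥N), r.comp s = LinearMap.id)))

end Count

section Fac

variable (A : Type) [Ring A]

/-- `fac(T)`: the class of factor modules of finite direct sums of copies of `T`. -/
def facP (T : Type) [AddCommGroup T] [Module A T]
    (M : Type) [AddCommGroup M] [Module A M] : Prop :=
  ∃ (n : ℕ) (f : (Fin n → T) →ₗ[A] M), Function.Surjective f

/-- `M` is a direct summand of `N`. -/
def isSummand (M N : Type) [AddCommGroup M] [Module A M] [AddCommGroup N] [Module A N] :
    Prop :=
  ∃ (s : M →ₗ[A] N) (r : N →ₗ[A] M), r.comp s = LinearMap.id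

/-- `add(T)`: direct summands of finite direct sums of copies of `T`. -/
def addP (T : Type) [AddCommGroup T] [Module A T]
    (M : Type) [AddCommGroup M] [Module A M] : Prop :=
  ∃ n : ℕ, isSummand A M (Fin n → T)

/-- The module `T` has projective dimension at most one. -/
def pdLeOne (T : Type) [AddCommGroup T] [Module A T] : Prop :=
  ∃ (P₀ P₁ : ModuleCat.{0} A) (_ : Module.Projective A ↥P₀) (_ : Module.Projective A ↥P₁)
    (i : ↥P₁ →ₗ[A] ↥P₀) (p : ↥P₀ →ₗ[A] T),
      Function.Injective i ∧ Function.Surjective p ∧ Function.Exact i p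

/-- `M` is a projective object of the exact category `fac(T)`. -/
def projInFac (T : Type) [AddCommGroup T] [Module A T]
    (M : Type) [AddCommGroup M] [Module A M] : Prop :=
  facP A T M ∧ ∀ (X Y Z : Type) [AddCommGroup X] [Module A X] [AddCommGroup Y] [Module A Y]
    [AddCommGroup Z] [Module A Z] (i : X →ₗ[A] Y) (p : Y →ₗ[A] Z),
      Function.Injective i → Function.Surjective p → Function.Exact i p →
      facP A T X → facP A T Y → facP A T Z →
      ∀ g : M →ₗ[A] Z, ∃ h : M →ₗ[A] Y, p.comp h = g

end Fac

/-- `T` is `τ`-rigid, via the Auslander–Smalø criterion `Ext¹_A(T, fac(T)) = 0`. -/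
def tauRigid (A : Type) [Ring A] (T : Type) [AddCommGroup T] [Module A T] : Prop :=
  ∀ (M : Type) [AddCommGroup M] [Module A M], facP A T M → Subsingleton (egrp A 1 T M)


section TauAux
open CategoryTheory

/-- lifting along surjections with kernel in `fac T`. -/
def ELift (A : Type) [Ring A] (T : Type) [AddCommGroup T] [Module A T]
    (M : Type) [AddCommGroup M] [Module A M] : Prop :=
  ∀ (Y Z : Type) [AddCommGroup Y] [Module A Y] [AddCommGroup Z] [Module A Z]
    (q : Y →ₗ[A] Z), Function.Surjective q → facP A T (LinearMap.ker q) →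
    ∀ f : M →ₗ[A] Z, ∃ g : M →ₗ[A] Y, q.comp g = f

lemma ext_factor (A : Type) [Ring A] (T X : Type) [AddCommGroup T] [Module A T]
    [AddCommGroup X] [Module A X] (h : Subsingleton (egrp A 1 T X))
    (P : ProjectiveResolution (ModuleCat.of A T))
    (b : P.complex.X 1 ⟶ ModuleCat.of A X) (hb : P.complex.d 2 1 ≫ b = 0) :
    ∃ c : P.complex.X 0 ⟶ ModuleCat.of A X, P.complex.d 1 0 ≫ c = b := by
  have hz : Limits.IsZero (((_root_.Ext ℤ (ModuleCat A) 1).obj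
      (Opposite.op (ModuleCat.of A T))).obj (ModuleCat.of A X)) :=
    @ModuleCat.isZero_of_subsingleton _ _ _ h
  have hz2 := hz.of_iso (P.isoExt (R := ℤ) 1 (ModuleCat.of A X)).symm
  rw [← HomologicalComplex.exactAt_iff_isZero_homology,
    HomologicalComplex.exactAt_iff' _ 0 1 2 (by simp) (by simp),
    ShortComplex.moduleCat_exact_iff] at hz2
  obtain ⟨c, hc⟩ := hz2 b hb
  exact ⟨c, hc⟩

lemma elift_of_tauRigid (A : Type) [Ring A] (T : Type) [AddCommGroup T] [Module A T]
    (h : tauRigid A T) : ELift A T T := by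
  intro Y Z _ _ _ _ q hq hk f
  let P := projectiveResolution (ModuleCat.of A T)
  let ε : P.complex.X 0 ⟶ ModuleCat.of A T := P.π.f 0
  have hε : Epi ε := inferInstanceAs (Epi (P.π.f 0))
  have hεs : Function.Surjective ε.hom := (ModuleCat.epi_iff_surjective ε).1 hε
  have hqe : Epi (ModuleCat.ofHom q) := (ModuleCat.epi_iff_surjective _).2 hq
  let a : P.complex.X 0 ⟶ ModuleCat.of A Y :=
    Projective.factorThru (ε ≫ ModuleCat.ofHom f) (ModuleCat.ofHom q)
  have ha : a ≫ ModuleCat.ofHom q = ε ≫ ModuleCat.ofHom f := Projective.factorThru_comp _ _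
  have ha' : ∀ x, q (a.hom x) = f (ε.hom x) := fun x => by
    simpa using congrArg (fun g => g.hom x) ha
  have hdε : ∀ x, ε.hom ((P.complex.d 1 0).hom x) = 0 := fun x => by
    have := congrArg (fun g => g.hom x) P.complex_d_comp_π_f_zero
    exact this
  let b0 : P.complex.X 1 →ₗ[A] LinearMap.ker q :=
    LinearMap.codRestrict _ (a.hom.comp (P.complex.d 1 0).hom) (by
      intro x; simp [LinearMap.mem_ker, ha', hdε])
  have hdd : ∀ x, (P.complex.d 1 0).hom ((P.complex.d 2 1).hom x) = 0 := fun x => by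
    have := congrArg (fun g => g.hom x) (P.complex.d_comp_d 2 1 0)
    exact this
  obtain ⟨c, hc⟩ := ext_factor A T _ (h _ hk) P (ModuleCat.ofHom b0) (by
    ext x
    show a.hom ((P.complex.d 1 0).hom ((P.complex.d 2 1).hom x)) = 0
    rw [hdd, map_zero])
  have hc' : ∀ x, ((c.hom ((P.complex.d 1 0).hom x) : LinearMap.ker q) : Y) =
      a.hom ((P.complex.d 1 0).hom x) := fun x => by
    have := congrArg (fun g => g.hom x) hc
    exact congrArg Subtype.val this
  let a' : P.complex.X 0 →ₗ[A] Y := a.hom - (LinearMap.ker q).subtype.comp c.hom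
  have hex : ∀ x, ε.hom x = 0 → ∃ y, (P.complex.d 1 0).hom y = x := by
    have := P.exact₀
    rw [ShortComplex.moduleCat_exact_iff] at this
    exact this
  have hker : LinearMap.ker ε.hom ≤ LinearMap.ker a' := by
    intro x hx
    obtain ⟨y, rfl⟩ := hex x hx
    simp [a', hc']
  let g : T →ₗ[A] Y := ((LinearMap.ker ε.hom).liftQ a' hker).comp
    (ε.hom.quotKerEquivOfSurjective hεs).symm.toLinearMap
  refine ⟨g, ?_⟩
  ext t
  obtain ⟨x, rfl⟩ := hεs t
  have : (ε.hom.quotKerEquivOfSurjective hεs).symm (ε.hom x) = Submodule.Quotient.mk x := by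
    rw [LinearEquiv.symm_apply_eq]; rfl
  show q (((LinearMap.ker ε.hom).liftQ a' hker) ((ε.hom.quotKerEquivOfSurjective hεs).symm (ε.hom x))) = _
  rw [this]
  show q (a.hom x - (c.hom x : LinearMap.ker q)) = _
  have h2 : q ((c.hom x : LinearMap.ker q) : Y) = 0 := (c.hom x : LinearMap.ker q).2
  rw [map_sub, ha', h2, sub_zero]
end TauAux

section TauAux2

lemma factor_surj {A : Type} [Ring A] {P M Y : Type} [AddCommGroup P] [Module A P]
    [AddCommGroup M] [Module A M] [AddCommGroup Y] [Module A Y] (p : P →ₗ[A] M)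
    (hp : Function.Surjective p) (a : P →ₗ[A] Y) (h : ∀ x, p x = 0 → a x = 0) :
    ∃ g : M →ₗ[A] Y, ∀ x, g (p x) = a x := by
  refine ⟨((LinearMap.ker p).liftQ a (fun x hx => h x hx)).comp
    (p.quotKerEquivOfSurjective hp).symm.toLinearMap, fun x => ?_⟩
  have : (p.quotKerEquivOfSurjective hp).symm (p x) = Submodule.Quotient.mk x := by
    rw [LinearEquiv.symm_apply_eq]; rfl
  rw [LinearMap.comp_apply, LinearEquiv.coe_coe, this]
  rfl

lemma facP.of_surj {A : Type} [Ring A] {T X Y : Type} [AddCommGroup T] [Module A T]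
    [AddCommGroup X] [Module A X] [AddCommGroup Y] [Module A Y] (h : facP A T X)
    (f : X →ₗ[A] Y) (hf : Function.Surjective f) : facP A T Y := by
  obtain ⟨n, g, hg⟩ := h
  exact ⟨n, f.comp g, hf.comp hg⟩

lemma facP.pi {A : Type} [Ring A] (T : Type) [AddCommGroup T] [Module A T] (n : ℕ) :
    facP A T (Fin n → T) := ⟨n, LinearMap.id, Function.surjective_id⟩

lemma facP.self {A : Type} [Ring A] (T : Type) [AddCommGroup T] [Module A T] :
    facP A T T := ⟨1, LinearMap.proj 0, fun t => ⟨fun _ => t, rfl⟩⟩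

lemma ELift.summand {A : Type} [Ring A] {T M N : Type} [AddCommGroup T] [Module A T]
    [AddCommGroup M] [Module A M] [AddCommGroup N] [Module A N] (h : ELift A T N)
    (s : M →ₗ[A] N) (r : N →ₗ[A] M) (hrs : r.comp s = LinearMap.id) : ELift A T M := by
  intro Y Z _ _ _ _ q hq hk f
  obtain ⟨g, hg⟩ := h Y Z q hq hk (f.comp r)
  refine ⟨g.comp s, ?_⟩
  rw [← LinearMap.comp_assoc, hg, LinearMap.comp_assoc, hrs, LinearMap.comp_id]

lemma ELift.extend {A : Type} [Ring A] {T M P X : Type} [AddCommGroup T] [Module A T]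
    [AddCommGroup M] [Module A M] [AddCommGroup P] [Module A P] [AddCommGroup X] [Module A X]
    (h : ELift A T M) (p : P →ₗ[A] M) (hp : Function.Surjective p) (hX : facP A T X)
    (g : LinearMap.ker p →ₗ[A] X) : ∃ e : P →ₗ[A] X, ∀ k : LinearMap.ker p, e k = g k := by
  let N : Submodule A (P × X) := LinearMap.range ((LinearMap.ker p).subtype.prod (-g))
  let q : ((P × X) ⧸ N) →ₗ[A] M := N.liftQ (p.comp (LinearMap.fst A P X)) (by
    rintro _ ⟨k, rfl⟩
    exact k.2)
  let j : X →ₗ[A] LinearMap.ker q := LinearMap.codRestrict _ (N.mkQ.comp (LinearMap.inr A P X))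
    (by intro x; show p 0 = 0; simp)
  have hjmk : ∀ x, ((j x : LinearMap.ker q) : (P × X) ⧸ N) = N.mkQ (0, x) := fun _ => rfl
  have hrel : ∀ k : LinearMap.ker p, N.mkQ ((k : P), 0) = N.mkQ (0, g k) := by
    intro k
    rw [← sub_eq_zero, ← map_sub]
    rw [Submodule.mkQ_apply, Submodule.Quotient.mk_eq_zero]
    exact ⟨k, by simp⟩
  have hjs : Function.Surjective j := by
    rintro ⟨y, hy⟩
    obtain ⟨⟨a, x⟩, rfl⟩ := N.mkQ_surjective y
    have ha : p a = 0 := hy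
    refine ⟨g ⟨a, ha⟩ + x, Subtype.ext ?_⟩
    rw [hjmk]
    show N.mkQ (0, g ⟨a, ha⟩ + x) = N.mkQ (a, x)
    have := hrel ⟨a, ha⟩
    have e1 : ((a, x) : P × X) = (a, 0) + (0, x) := by simp
    have e2 : ((0, g ⟨a, ha⟩ + x) : P × X) = (0, g ⟨a, ha⟩) + (0, x) := by simp
    rw [e1, e2, map_add, map_add, ← this]
  have hji : Function.Injective j := by
    rw [injective_iff_map_eq_zero]
    intro x hx
    have : N.mkQ (0, x) = 0 := by rw [← hjmk, hx]; rfl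
    rw [Submodule.mkQ_apply, Submodule.Quotient.mk_eq_zero] at this
    obtain ⟨k, hk⟩ := this
    have h1 : (k : P) = 0 := congrArg Prod.fst hk
    have h2 : -g k = x := congrArg Prod.snd hk
    have h3 : k = 0 := Subtype.ext h1
    rw [← h2, h3]; simp
  let J := LinearEquiv.ofBijective j ⟨hji, hjs⟩
  have hqs : Function.Surjective q := fun m => by
    obtain ⟨a, rfl⟩ := hp m
    exact ⟨N.mkQ (a, 0), rfl⟩
  obtain ⟨s, hs⟩ := h _ _ q hqs (hX.of_surj j hjs) LinearMap.id
  have hs' : ∀ m, q (s m) = m := fun m => congrArg (fun f => f m) hs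
  let ρ : P →ₗ[A] LinearMap.ker q := LinearMap.codRestrict _
    (N.mkQ.comp (LinearMap.inl A P X) - s.comp p) (by
      intro x
      rw [LinearMap.mem_ker, LinearMap.sub_apply, map_sub]
      show p x - q (s (p x)) = 0
      rw [hs', sub_self])
  refine ⟨J.symm.toLinearMap.comp ρ, fun k => ?_⟩
  show J.symm (ρ k) = g k
  rw [LinearEquiv.symm_apply_eq]
  apply Subtype.ext
  show N.mkQ ((k : P), 0) - s (p k) = N.mkQ (0, g k)
  rw [hrel, k.2, map_zero, sub_zero]

end TauAux2

section TauAux3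

lemma facP.of_fintype {A : Type} [Ring A] {T X : Type} [AddCommGroup T] [Module A T]
    [AddCommGroup X] [Module A X] {ι : Type} [Fintype ι] (f : (ι → T) →ₗ[A] X)
    (hf : Function.Surjective f) : facP A T X := by
  let e := LinearEquiv.funCongrLeft A T (Fintype.equivFin ι)
  exact ⟨Fintype.card ι, f.comp e.toLinearMap, hf.comp e.surjective⟩

lemma smul_top_killed {A : Type} [Ring A] {J : Ideal A} {P W : Type} [AddCommGroup P] [Module A P]
    [AddCommGroup W] [Module A W] (hW : ∀ a ∈ J, ∀ w : W, a • w = 0) (h : P →ₗ[A] W)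
    (x : P) (hx : x ∈ J • (⊤ : Submodule A P)) : h x = 0 := by
  induction hx using Submodule.smul_induction_on' with
  | smul a ha n hn => rw [map_smul, hW a ha]
  | add x hx y hy h1 h2 => rw [map_add, h1, h2, add_zero]

lemma lpa {A : Type} [Ring A] {T M P : Type} [AddCommGroup T] [Module A T]
    [AddCommGroup M] [Module A M] [AddCommGroup P] [Module A P] [Module.Projective A P]
    {J : Ideal A} (hJ : ∀ a, a ∈ J ↔ ∀ t : T, a • t = 0)
    {n : ℕ} (v : Fin n → T) (hv : ∀ a : A, (∀ i, a • v i = 0) → a ∈ J)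
    (hM : ELift A T M) (p : P →ₗ[A] M) (hp : Function.Surjective p)
    [Module.Finite A (LinearMap.ker p)]
    {Y Z : Type} [AddCommGroup Y] [Module A Y] [AddCommGroup Z] [Module A Z]
    (hY : ∀ a ∈ J, ∀ y : Y, a • y = 0) (q : Y →ₗ[A] Z) (hq : Function.Surjective q)
    (g : LinearMap.ker p →ₗ[A] Z)
    (hg : ∀ k : LinearMap.ker p, (k : P) ∈ J • (⊤ : Submodule A P) → g k = 0) :
    ∃ g' : LinearMap.ker p →ₗ[A] Y, (∀ k, q (g' k) = g k) ∧
      ∀ k : LinearMap.ker p, (k : P) ∈ J • (⊤ : Submodule A P) → g' k = 0 := by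
  obtain ⟨m, c, hc⟩ := Module.Finite.exists_fin' A (LinearMap.ker p)
  let Φ : (Fin m → A) →ₗ[A] (Fin m × Fin n → T) :=
    { toFun := fun a ji => a ji.1 • v ji.2
      map_add' := fun a b => by ext; simp [add_smul]
      map_smul' := fun a b => by ext; simp [mul_smul] }
  have hΦ : ∀ a ji, Φ a ji = a ji.1 • v ji.2 := fun _ _ => rfl
  have hW : ∀ a ∈ J, ∀ w : (Fin m × Fin n → T), a • w = 0 := by
    intro a ha w; ext ji; exact (hJ a).1 ha _
  let N' : Submodule A (Fin m → A) :=
    Submodule.comap ((LinearMap.ker p).subtype.comp c) (J • (⊤ : Submodule A P))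
  let D := Submodule.map Φ N'
  obtain ⟨θ, hθ⟩ := factor_surj c hc (D.mkQ.comp Φ) (by
    intro a ha
    rw [LinearMap.comp_apply, Submodule.mkQ_apply, Submodule.Quotient.mk_eq_zero]
    refine ⟨a, ?_, rfl⟩
    show ((c a : LinearMap.ker p) : P) ∈ J • (⊤ : Submodule A P)
    rw [ha]; exact Submodule.zero_mem _)
  obtain ⟨h, hh⟩ := hM.extend p hp (facP.of_fintype D.mkQ D.mkQ_surjective) θ
  obtain ⟨h', hh'⟩ := Module.projective_lifting_property D.mkQ h D.mkQ_surjective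
  have key : ∀ k : LinearMap.ker p, ∃ a : Fin m → A, h' k = Φ a ∧
      ((c a - k : LinearMap.ker p) : P) ∈ J • (⊤ : Submodule A P) := by
    intro k
    obtain ⟨a, rfl⟩ := hc k
    have h1 : D.mkQ (h' (c a : LinearMap.ker p)) = D.mkQ (Φ a) := by
      rw [← LinearMap.comp_apply, hh', hh, hθ]; rfl
    rw [← sub_eq_zero, ← map_sub, Submodule.mkQ_apply, Submodule.Quotient.mk_eq_zero] at h1
    obtain ⟨b, hb, hb'⟩ := h1
    refine ⟨a + b, ?_, ?_⟩
    · rw [map_add, hb']; abel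
    · have : c (a + b) - c a = c b := by rw [map_add]; abel
      rw [this]; exact hb
  obtain ⟨l, hl⟩ := Module.projective_lifting_property q (g.comp c) hq
  obtain ⟨l', hl'⟩ := factor_surj Φ.rangeRestrict Φ.surjective_rangeRestrict l (by
    intro a ha
    have ha' : Φ a = 0 := congrArg Subtype.val ha
    have haJ : ∀ j, a j ∈ J := fun j => hv _ (fun i => by rw [← hΦ a (j, i), ha']; rfl)
    rw [LinearMap.pi_apply_eq_sum_univ l a]
    exact Finset.sum_eq_zero fun j _ => hY _ (haJ j) _)
  let hr : LinearMap.ker p →ₗ[A] LinearMap.range Φ := LinearMap.codRestrict _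
    (h'.comp (LinearMap.ker p).subtype) (by
      intro k
      obtain ⟨a, ha, _⟩ := key k
      exact ⟨a, ha.symm⟩)
  refine ⟨l'.comp hr, fun k => ?_, fun k hk => ?_⟩
  · obtain ⟨a, ha, hak⟩ := key k
    have : hr k = Φ.rangeRestrict a := Subtype.ext ha
    rw [LinearMap.comp_apply, this, hl', ← LinearMap.comp_apply, hl]
    have h2 := hg _ hak
    rw [map_sub, sub_eq_zero] at h2
    exact h2
  · have : hr k = 0 := Subtype.ext (smul_top_killed hW h' _ hk)
    rw [LinearMap.comp_apply, this, map_zero]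

lemma exists_nonzero_to_fac {A : Type} [Ring A] {T D : Type} [AddCommGroup T] [Module A T]
    [AddCommGroup D] [Module A D] {J : Ideal A} (hJ : ∀ a, a ∈ J ↔ ∀ t : T, a • t = 0)
    {n : ℕ} (v : Fin n → T) (hv : ∀ a : A, (∀ i, a • v i = 0) → a ∈ J)
    [Module.Finite A D] [Nontrivial D] (hD : ∀ a ∈ J, ∀ d : D, a • d = 0) :
    ∃ (N : Submodule A (Fin n → T)) (f : D →ₗ[A] ((Fin n → T) ⧸ N)) (d : D), f d ≠ 0 := by
  obtain ⟨N0, hN0, -⟩ := (eq_top_or_exists_le_coatom (⊥ : Submodule A D)).resolve_left bot_ne_top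
  have hs : IsSimpleModule A (D ⧸ N0) := isSimpleModule_iff_isCoatom.2 hN0
  have hnt : Nontrivial (D ⧸ N0) := IsSimpleModule.nontrivial A _
  obtain ⟨s0, hs0⟩ := exists_ne (0 : D ⧸ N0)
  obtain ⟨d, rfl⟩ := N0.mkQ_surjective s0
  let w : A →ₗ[A] D ⧸ N0 := LinearMap.toSpanSingleton A _ (N0.mkQ d)
  have hw : Function.Surjective w := IsSimpleModule.toSpanSingleton_surjective A hs0
  let u : A →ₗ[A] (Fin n → T) := LinearMap.toSpanSingleton A _ v
  let N := Submodule.map u (LinearMap.ker w)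
  obtain ⟨f, hf⟩ := factor_surj w hw (N.mkQ.comp u) (by
    intro a ha
    rw [LinearMap.comp_apply, Submodule.mkQ_apply, Submodule.Quotient.mk_eq_zero]
    exact ⟨a, ha, rfl⟩)
  refine ⟨N, f.comp N0.mkQ, d, fun h0 => hs0 ?_⟩
  have h1 : w 1 = N0.mkQ d := by simp [w]
  rw [LinearMap.comp_apply, ← h1, hf, LinearMap.comp_apply, Submodule.mkQ_apply,
    Submodule.Quotient.mk_eq_zero] at h0
  obtain ⟨b, hb, hb'⟩ := h0
  have h2 : (1 - b) ∈ J := hv _ (fun i => by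
    have := congrFun hb' i
    simp only [u, LinearMap.toSpanSingleton_apply, Pi.smul_apply, one_smul] at this
    rw [sub_smul, this, one_smul, sub_self])
  have h3 : w (1 - b) = 0 := by
    show (1 - b) • N0.mkQ d = 0
    rw [← map_smul, hD _ h2, map_zero]
  rw [map_sub, hb, sub_zero, h1] at h3
  exact h3

lemma stepb {A : Type} [Ring A] {T M P : Type} [AddCommGroup T] [Module A T]
    [AddCommGroup M] [Module A M] [AddCommGroup P] [Module A P] [Module.Projective A P]
    {J : Ideal A} (hJ : ∀ a, a ∈ J ↔ ∀ t : T, a • t = 0)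
    {n : ℕ} (v : Fin n → T) (hv : ∀ a : A, (∀ i, a • v i = 0) → a ∈ J)
    (hM : ELift A T M) (p : P →ₗ[A] M) (hp : Function.Surjective p)
    [IsNoetherian A P] (k : LinearMap.ker p) (hk : (k : P) ∈ J • (⊤ : Submodule A P)) :
    k ∈ J • (⊤ : Submodule A (LinearMap.ker p)) := by
  by_contra hne
  have two : ∀ a ∈ J, ∀ b, a * b ∈ J := fun a ha b => (hJ _).2 fun t => by
    rw [mul_smul]; exact (hJ a).1 ha _
  let JK := J • (⊤ : Submodule A (LinearMap.ker p))
  let JP : Submodule A (LinearMap.ker p) :=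
    Submodule.comap (LinearMap.ker p).subtype (J • (⊤ : Submodule A P))
  have hle : JK ≤ JP := by
    refine Submodule.smul_le.2 fun a ha x _ => ?_
    exact Submodule.smul_mem_smul ha trivial
  let q : ((LinearMap.ker p) ⧸ JK) →ₗ[A] ((LinearMap.ker p) ⧸ JP) := Submodule.factor hle
  have hqs : Function.Surjective q := Submodule.factor_surjective hle
  have hY : ∀ a ∈ J, ∀ y : (LinearMap.ker p) ⧸ JK, a • y = 0 := by
    intro a ha y
    obtain ⟨y, rfl⟩ := JK.mkQ_surjective y
    rw [← map_smul, Submodule.mkQ_apply, Submodule.Quotient.mk_eq_zero]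
    exact Submodule.smul_mem_smul ha trivial
  obtain ⟨g', hg1, hg2⟩ := lpa hJ v hv hM p hp hY q hqs JP.mkQ (fun k hk => by
    rw [Submodule.mkQ_apply, Submodule.Quotient.mk_eq_zero]; exact hk)
  let r : LinearMap.ker p →ₗ[A] LinearMap.ker q := LinearMap.codRestrict _ (JK.mkQ - g') (by
    intro x
    rw [LinearMap.mem_ker, LinearMap.sub_apply, map_sub, hg1, sub_eq_zero]
    rfl)
  have hr : ∀ x ∈ JP, ((r x : LinearMap.ker q) : (LinearMap.ker p) ⧸ JK) = JK.mkQ x := by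
    intro x hx
    show JK.mkQ x - g' x = _
    rw [hg2 x hx, sub_zero]
  have hnt : Nontrivial (LinearMap.ker q) := by
    refine ⟨⟨r k, 0, fun h0 => hne ?_⟩⟩
    have := hr k hk
    rw [h0] at this
    have h2 : JK.mkQ k = 0 := this.symm
    rwa [Submodule.mkQ_apply, Submodule.Quotient.mk_eq_zero] at h2
  obtain ⟨N, f, d, hd⟩ := exists_nonzero_to_fac (D := LinearMap.ker q) hJ v hv (by
    intro a ha y
    exact Subtype.ext (hY a ha y))
  obtain ⟨⟨d', hd'⟩⟩ : Nonempty {x : LinearMap.ker p // x ∈ JP ∧ JK.mkQ x = d.1} := by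
    obtain ⟨y, hy⟩ := d
    obtain ⟨x, rfl⟩ := JK.mkQ_surjective y
    refine ⟨x, ?_, rfl⟩
    have : JP.mkQ x = 0 := hy
    rwa [Submodule.mkQ_apply, Submodule.Quotient.mk_eq_zero] at this
  obtain ⟨e, he⟩ := hM.extend p hp ((facP.pi T n).of_surj N.mkQ N.mkQ_surjective) (f.comp r)
  have hrd : r d' = d := Subtype.ext ((hr d' hd'.1).trans hd'.2)
  apply hd
  rw [← hrd, ← LinearMap.comp_apply, ← he]
  refine smul_top_killed ?_ e _ hd'.1
  intro a ha w
  obtain ⟨w, rfl⟩ := N.mkQ_surjective w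
  rw [← map_smul]
  have : a • w = 0 := by ext i; exact (hJ a).1 ha _
  rw [this, map_zero]

/-- `Hom(K,-)` is exact on modules killed by `J`. -/
lemma lpK {A : Type} [Ring A] {T M P : Type} [AddCommGroup T] [Module A T]
    [AddCommGroup M] [Module A M] [AddCommGroup P] [Module A P] [Module.Projective A P]
    {J : Ideal A} (hJ : ∀ a, a ∈ J ↔ ∀ t : T, a • t = 0)
    {n : ℕ} (v : Fin n → T) (hv : ∀ a : A, (∀ i, a • v i = 0) → a ∈ J)
    (hM : ELift A T M) (p : P →ₗ[A] M) (hp : Function.Surjective p) [IsNoetherian A P]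
    {Y Z : Type} [AddCommGroup Y] [Module A Y] [AddCommGroup Z] [Module A Z]
    (hY : ∀ a ∈ J, ∀ y : Y, a • y = 0) (q : Y →ₗ[A] Z) (hq : Function.Surjective q)
    (g : LinearMap.ker p →ₗ[A] Z) :
    ∃ g' : LinearMap.ker p →ₗ[A] Y, q.comp g' = g := by
  obtain ⟨g', h1, -⟩ := lpa hJ v hv hM p hp hY q hq g (fun k hk => by
    refine smul_top_killed ?_ g _ (stepb hJ v hv hM p hp k hk)
    intro a ha z
    obtain ⟨y, rfl⟩ := hq z
    rw [← map_smul, hY a ha, map_zero])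
  exact ⟨g', LinearMap.ext h1⟩

end TauAux3

section TauAux4
open TensorProduct

/-- pure tensors -/
noncomputable def btmk {A : Type} [Ring A] {X T : Type} [AddCommGroup X] [Module Aᵐᵒᵖ X]
    [AddCommGroup T] [Module A T] (x : X) (t : T) : balTensor ℤ A X T :=
  (balRel ℤ A X T).mkQ (x ⊗ₜ[ℤ] t)

section
variable {A : Type} [Ring A] {X T : Type} [AddCommGroup X] [Module Aᵐᵒᵖ X]
    [AddCommGroup T] [Module A T]

lemma btmk_add_left (x y : X) (t : T) : btmk (A := A) (x + y) t = btmk x t + btmk y t := by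
  unfold btmk; rw [TensorProduct.add_tmul]; exact map_add _ _ _

lemma btmk_add_right (x : X) (t u : T) : btmk (A := A) x (t + u) = btmk x t + btmk x u := by
  unfold btmk; rw [TensorProduct.tmul_add]; exact map_add _ _ _

lemma btmk_zero_right (x : X) : btmk (A := A) x (0 : T) = 0 := by
  unfold btmk; rw [TensorProduct.tmul_zero]; exact map_zero _

lemma btmk_zero_left (t : T) : btmk (A := A) (0 : X) t = 0 := by
  unfold btmk; rw [TensorProduct.zero_tmul]; exact map_zero _

lemma btmk_smul (x : X) (a : A) (t : T) :
    btmk (A := A) (MulOpposite.op a • x) t = btmk x (a • t) := by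
  exact (Submodule.Quotient.eq (balRel ℤ A X T)).2 (Submodule.subset_span ⟨x, a, t, rfl⟩)

lemma bt_induction {C : balTensor ℤ A X T → Prop} (h0 : C 0) (h1 : ∀ x t, C (btmk x t))
    (h2 : ∀ a b, C a → C b → C (a + b)) (z : balTensor ℤ A X T) : C z := by
  obtain ⟨w, rfl⟩ := (balRel ℤ A X T).mkQ_surjective z
  induction w using TensorProduct.induction_on with
  | zero => rw [map_zero]; exact h0
  | tmul x t => exact h1 x t
  | add a b ha hb => rw [map_add]; exact h2 _ _ ha hb

lemma bt_lift {G : Type} [AddCommGroup G] (β : X → T → G)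
    (hl : ∀ (x y : X) (t : T), β (x + y) t = β x t + β y t) (hr : ∀ (x : X) (t u : T), β x (t + u) = β x t + β x u)
    (hb : ∀ (x : X) (a : A) (t : T), β (MulOpposite.op a • x) t = β x (a • t)) :
    ∃ F : balTensor ℤ A X T →+ G, ∀ x t, F (btmk x t) = β x t := by
  let b : X →+ T →+ G := AddMonoidHom.mk' (fun x => AddMonoidHom.mk' (β x) (hr x))
    (fun x y => by ext t; exact hl x y t)
  let b' : X →ₗ[ℤ] T →ₗ[ℤ] G :=
    (AddMonoidHom.mk' (fun x => (b x).toIntLinearMap) (fun x y => by ext t; exact hl x y t)).toIntLinearMap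
  let F0 : X ⊗[ℤ] T →ₗ[ℤ] G := TensorProduct.lift b'
  have hF0 : ∀ x t, F0 (x ⊗ₜ t) = β x t := fun x t => TensorProduct.lift.tmul x t
  let F1 : ((X ⊗[ℤ] T) ⧸ balRel ℤ A X T) →ₗ[ℤ] G := (balRel ℤ A X T).liftQ F0 (by
    refine Submodule.span_le.2 ?_
    rintro _ ⟨x, a, t, rfl⟩
    show F0 _ = 0
    rw [map_sub, hF0, hF0, hb, sub_self])
  exact ⟨F1.toAddMonoidHom, fun x t => hF0 x t⟩

lemma balMap_btmk {T' : Type} [AddCommGroup T'] [Module A T'] (f : T →ₗ[A] T') (x : X) (t : T) :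
    balMap ℤ A X f (btmk x t) = btmk x (f t) := rfl

end

section
variable {A : Type} [Ring A] (I : TwoSidedIdeal A)

lemma ev_exists (T : Type) [AddCommGroup T] [Module A T] :
    ∃ F : balTensor ℤ A (rIdeal A I) T →+ T, ∀ x t, F (btmk x t) = (x : A) • t :=
  bt_lift (fun (x : rIdeal A I) (t : T) => (x : A) • t) (fun x y t => by simp [add_smul]) (fun x t u => smul_add _ _ _)
    (fun x a t => by
      show ((x : A) * a) • t = _
      rw [mul_smul])

/-- evaluation map -/
noncomputable def ev (T : Type) [AddCommGroup T] [Module A T] :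
    balTensor ℤ A (rIdeal A I) T →+ T := (ev_exists I T).choose

lemma ev_btmk (T : Type) [AddCommGroup T] [Module A T] (x : rIdeal A I) (t : T) :
    ev I T (btmk x t) = (x : A) • t := (ev_exists I T).choose_spec x t

lemma ev_nat {T T' : Type} [AddCommGroup T] [Module A T] [AddCommGroup T'] [Module A T']
    (f : T →ₗ[A] T') (z : balTensor ℤ A (rIdeal A I) T) :
    ev I T' (balMap ℤ A _ f z) = f (ev I T z) := by
  induction z using bt_induction with
  | h0 => simp
  | h1 x t => rw [balMap_btmk, ev_btmk, ev_btmk, map_smul]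
  | h2 a b ha hb => rw [map_add, map_add, map_add, map_add, ha, hb]

lemma ev_surj {T : Type} [AddCommGroup T] [Module A T] {J : Ideal A} (hJ : ∀ a, a ∈ J ↔ a ∈ I)
    (y : T) (hy : y ∈ J • (⊤ : Submodule A T)) : ∃ z, ev I T z = y := by
  induction hy using Submodule.smul_induction_on' with
  | smul a ha n hn => exact ⟨btmk ⟨a, (hJ a).1 ha⟩ n, ev_btmk _ _ _ _⟩
  | add x hx y hy h1 h2 =>
    obtain ⟨z, rfl⟩ := h1
    obtain ⟨w, rfl⟩ := h2
    exact ⟨z + w, map_add _ _ _⟩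

lemma ev_free_inj (ι : Type) (z : balTensor ℤ A (rIdeal A I) (ι →₀ A))
    (hz : ev I _ z = 0) : z = 0 := by
  classical
  have hmem : ∀ z i, ev I (ι →₀ A) z i ∈ rIdeal A I := by
    intro z i
    induction z using bt_induction with
    | h0 => simp
    | h1 x t =>
      rw [ev_btmk]
      exact I.mul_mem_right _ _ x.2
    | h2 a b ha hb => rw [map_add]; exact Submodule.add_mem _ ha hb
  have key : ∀ z, ∃ s : Finset ι, ∀ s', s ⊆ s' →
      z = ∑ i ∈ s', btmk (A := A) (⟨_, hmem z i⟩ : rIdeal A I) (Finsupp.single i (1 : A)) := by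
    intro z
    induction z using bt_induction with
    | h0 =>
      refine ⟨∅, fun s' _ => (Finset.sum_eq_zero fun i _ => ?_).symm⟩
      have : (⟨_, hmem 0 i⟩ : rIdeal A I) = 0 := Subtype.ext (by simp)
      rw [this, btmk_zero_left]
    | h1 x t =>
      refine ⟨t.support, fun s' hs' => ?_⟩
      have h1 : t = ∑ i ∈ s', t i • Finsupp.single i (1 : A) := by
        conv_lhs => rw [← Finsupp.sum_single t]
        rw [Finsupp.sum_of_support_subset _ hs' _ (by simp)]
        exact Finset.sum_congr rfl fun i _ => by simp
      have h2 : ∀ (s : Finset ι), btmk (A := A) x (∑ i ∈ s, t i • Finsupp.single i (1 : A)) =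
          ∑ i ∈ s, btmk x (t i • Finsupp.single i (1 : A)) := by
        intro s
        induction s using Finset.induction_on with
        | empty => simp [btmk_zero_right]
        | insert i s hi ih => rw [Finset.sum_insert hi, Finset.sum_insert hi, btmk_add_right, ih]
      conv_lhs => rw [h1, h2]
      refine Finset.sum_congr rfl fun i _ => ?_
      rw [← btmk_smul]
      congr 1
      apply Subtype.ext
      show (x : A) * t i = ev I _ (btmk x t) i
      rw [ev_btmk]; rfl
    | h2 a b ha hb =>
      obtain ⟨s, hs⟩ := ha
      obtain ⟨u, hu⟩ := hb
      refine ⟨s ∪ u, fun s' hs' => ?_⟩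
      conv_lhs => rw [hs s' (Finset.union_subset_left hs'), hu s' (Finset.union_subset_right hs')]
      rw [← Finset.sum_add_distrib]
      refine Finset.sum_congr rfl fun i _ => ?_
      rw [← btmk_add_left]
      congr 1
      apply Subtype.ext
      show ev I _ a i + ev I _ b i = ev I _ (a + b) i
      rw [map_add]; rfl
  obtain ⟨s, hs⟩ := key z
  rw [hs s subset_rfl]
  refine Finset.sum_eq_zero fun i _ => ?_
  have : (⟨_, hmem z i⟩ : rIdeal A I) = 0 := Subtype.ext (by simp [hz])
  rw [this, btmk_zero_left]

lemma balMap_comp {X : Type} [AddCommGroup X] [Module Aᵐᵒᵖ X]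
    {T T' T'' : Type} [AddCommGroup T] [Module A T] [AddCommGroup T'] [Module A T']
    [AddCommGroup T''] [Module A T''] (f : T →ₗ[A] T') (g : T' →ₗ[A] T'')
    (z : balTensor ℤ A X T) : balMap ℤ A X g (balMap ℤ A X f z) = balMap ℤ A X (g.comp f) z := by
  induction z using bt_induction with
  | h0 => simp
  | h1 x t => rfl
  | h2 a b ha hb => simp only [map_add, ha, hb]

lemma balMap_zero {X : Type} [AddCommGroup X] [Module Aᵐᵒᵖ X]
    {T T' : Type} [AddCommGroup T] [Module A T] [AddCommGroup T'] [Module A T']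
    (f : T →ₗ[A] T') (hf : ∀ t, f t = 0)
    (z : balTensor ℤ A X T) : balMap ℤ A X f z = 0 := by
  induction z using bt_induction with
  | h0 => simp
  | h1 x t => rw [balMap_btmk, hf, btmk_zero_right]
  | h2 a b ha hb => rw [map_add, ha, hb, add_zero]

/-- First half. -/
lemma tensor_zero {T ι K : Type} [AddCommGroup T] [Module A T] [AddCommGroup K] [Module A K]
    {J : Ideal A}
    (hJ : ∀ a, a ∈ J ↔ a ∈ I) (p : (ι →₀ A) →ₗ[A] T) (hp : Function.Surjective p)
    (inc : K →ₗ[A] (ι →₀ A)) (hinc : ∀ k, p (inc k) = 0)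
    (hkill : ∀ a ∈ J, ∀ t : T, a • t = 0)
    (hb : ∀ f, p f = 0 → f ∈ J • (⊤ : Submodule A (ι →₀ A)) →
      ∃ k ∈ J • (⊤ : Submodule A K), inc k = f) :
    Subsingleton (balTensor ℤ A (rIdeal A I) T) := by
  have : ∀ z : balTensor ℤ A (rIdeal A I) T, z = 0 := by
    intro z
    induction z using bt_induction with
    | h0 => rfl
    | h2 a b ha hb => rw [ha, hb, add_zero]
    | h1 x t =>
      obtain ⟨f, rfl⟩ := hp t
      have hx : (x : A) ∈ J := (hJ _).2 x.2
      have hk : p ((x : A) • f) = 0 := by rw [map_smul, hkill _ hx]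
      obtain ⟨k, hk1, hk2⟩ := hb _ hk (Submodule.smul_mem_smul hx trivial)
      obtain ⟨z, hz⟩ := ev_surj I hJ k hk1
      have h1 : btmk x f = balMap ℤ A (rIdeal A I) inc z := by
        rw [← sub_eq_zero]
        apply ev_free_inj
        rw [map_sub, ev_btmk, ev_nat, hz, hk2, sub_self]
      rw [← balMap_btmk, h1, balMap_comp]
      exact balMap_zero _ hinc z
  exact ⟨fun a b => by rw [this a, this b]⟩

lemma tor_crit {T K F : Type} [AddCommGroup T] [Module A T] {J : Ideal A}
    (hJ : ∀ a, a ∈ J ↔ a ∈ I) [AddCommGroup K] [Module A K]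
    (emb : K →ₗ[A] presKer A T) (ret : presKer A T →ₗ[A] K)
    (hre : ret.comp emb = LinearMap.id)
    (htor : Subsingleton (Tor1 ℤ A (rIdeal A I) T))
    [AddCommGroup F] [Module A F] (π : F →ₗ[A] K) (hπ : Function.Surjective π)
    (l : F) (hl : π l = 0) (hlJ : l ∈ J • (⊤ : Submodule A F)) :
    l ∈ J • LinearMap.ker π := by
  obtain ⟨z, hz⟩ := ev_surj I hJ l hlJ
  let z1 := balMap ℤ A (rIdeal A I) π z
  have hz1 : ev I _ z1 = 0 := by rw [ev_nat, hz, hl]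
  let z2 := balMap ℤ A (rIdeal A I) (T' := ↥(presKer A T)) emb z1
  have hz2 : ev I _ z2 = 0 := by rw [ev_nat, hz1, map_zero]
  have hz3 : balMap ℤ A (rIdeal A I) (T := ↥(presKer A T)) (T' := (T →₀ A)) (presKer A T).subtype z2 = 0 := by
    apply ev_free_inj
    rw [ev_nat, hz2, map_zero]
  have hz2' : z2 = 0 :=
    congrArg Subtype.val (htor.elim (⟨z2, hz3⟩ : Tor1 ℤ A (rIdeal A I) T) ⟨0, map_zero _⟩)
  have hz1' : z1 = 0 := by
    have h1 : balMap ℤ A (rIdeal A I) (T := ↥(presKer A T)) ret z2 = z1 := by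
      rw [balMap_comp, hre]
      generalize z1 = w
      induction w using bt_induction with
      | h0 => simp
      | h1 x t => rfl
      | h2 a b ha hb => rw [map_add, ha, hb]
    rw [← h1, hz2', map_zero]
  let JL := J • LinearMap.ker π
  let s := Function.surjInv hπ
  have hs : ∀ k, π (s k) = k := Function.surjInv_eq hπ
  have hmk : ∀ (x : A), x ∈ J → ∀ f f' : F, π f = π f' → JL.mkQ (x • f) = JL.mkQ (x • f') := by
    intro x hx f f' h
    rw [← sub_eq_zero, ← map_sub, ← smul_sub, Submodule.mkQ_apply, Submodule.Quotient.mk_eq_zero]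
    exact Submodule.smul_mem_smul hx (by rw [LinearMap.mem_ker, map_sub, h, sub_self])
  have hx : ∀ x : rIdeal A I, (x : A) ∈ J := fun x => (hJ _).2 x.2
  obtain ⟨β, hβ⟩ := bt_lift (A := A) (X := rIdeal A I) (T := K)
    (fun x k => JL.mkQ ((x : A) • s k))
    (fun x y t => by rw [← map_add, ← add_smul]; rfl)
    (fun x t u => by
      rw [← map_add, ← smul_add]
      exact hmk _ (hx x) _ _ (by rw [map_add, hs, hs, hs]))
    (fun x a t => by
      show JL.mkQ (((x : A) * a) • s t) = _
      rw [mul_smul]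
      exact hmk _ (hx x) _ _ (by rw [map_smul, hs, hs]))
  have hβz : ∀ z, β (balMap ℤ A (rIdeal A I) π z) = JL.mkQ (ev I _ z) := by
    intro z
    induction z using bt_induction with
    | h0 => simp
    | h1 x t =>
      rw [balMap_btmk, hβ, ev_btmk]
      exact hmk _ (hx x) _ _ (hs _)
    | h2 a b ha hb => rw [map_add, map_add, ha, hb, map_add, map_add]
  have h := hβz z
  rw [show balMap ℤ A (rIdeal A I) π z = 0 from hz1', map_zero, hz] at h
  have h' := h.symm
  rwa [Submodule.mkQ_apply, Submodule.Quotient.mk_eq_zero] at h'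

lemma emb_ret {A T : Type} [Ring A] [AddCommGroup T] [Module A T] (s : Finset T)
    (hp : Function.Surjective (Finsupp.linearCombination A (Subtype.val : s → T))) :
    ∃ (emb : LinearMap.ker (Finsupp.linearCombination A (Subtype.val : s → T)) →ₗ[A] presKer A T)
      (ret : presKer A T →ₗ[A] LinearMap.ker (Finsupp.linearCombination A (Subtype.val : s → T))),
      ret.comp emb = LinearMap.id := by
  classical
  set p := Finsupp.linearCombination A (Subtype.val : s → T)
  let e : (s →₀ A) →ₗ[A] (T →₀ A) := Finsupp.lmapDomain A A Subtype.val
  have he : ∀ f, Finsupp.linearCombination A (id : T → T) (e f) = p f := fun f => by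
    simp only [e, Finsupp.lmapDomain_apply, Finsupp.linearCombination_mapDomain]; rfl
  let ρ : T → (s →₀ A) := fun t =>
    if h : t ∈ s then Finsupp.single ⟨t, h⟩ 1 else Function.surjInv hp t
  have hρ : ∀ t, p (ρ t) = t := by
    intro t
    by_cases h : t ∈ s
    · simp [ρ, h, p]
    · simp only [ρ, h, dite_false]; exact Function.surjInv_eq hp t
  let r : (T →₀ A) →ₗ[A] (s →₀ A) := Finsupp.linearCombination A ρ
  have hr : ∀ f, p (r f) = Finsupp.linearCombination A (id : T → T) f := by
    intro f
    have : p.comp r = Finsupp.linearCombination A (id : T → T) := by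
      ext t; simp [r, hρ]
    exact congrArg (fun g => g f) this
  have hre : ∀ f, r (e f) = f := by
    intro f
    have : r.comp e = LinearMap.id := by
      ext i : 2
      simp [r, e, ρ]
    exact congrArg (fun g => g f) this
  refine ⟨LinearMap.codRestrict _ (e.comp (LinearMap.ker p).subtype) (fun k => ?_),
    LinearMap.codRestrict _ (r.comp (presKer A T).subtype) (fun k => ?_), ?_⟩
  · show Finsupp.linearCombination A (id : T → T) (e k) = 0
    rw [he]; exact k.2
  · show p (r k) = 0
    rw [hr]; exact k.2
  · ext k : 2
    exact hre k
end
end TauAux4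

section TauAux5

lemma mem_smul_ker {A : Type} [Ring A] {J : Ideal A} {F : Type} [AddCommGroup F] [Module A F]
    (L : Submodule A F) (x : F) (hx : x ∈ J • L) (hxL : x ∈ L) :
    (⟨x, hxL⟩ : L) ∈ J • (⊤ : Submodule A L) := by
  have h : Submodule.map L.subtype (J • (⊤ : Submodule A L)) = J • L := by
    rw [Submodule.map_smul'', Submodule.map_top, Submodule.range_subtype]
  rw [← h] at hx
  obtain ⟨y, hy, hyx⟩ := hx
  have : y = ⟨x, hxL⟩ := Subtype.ext hyx
  rwa [← this]

lemma killed_quot {A : Type} [Ring A] {J : Ideal A} {F : Type} [AddCommGroup F] [Module A F] :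
    ∀ a ∈ J, ∀ y : F ⧸ (J • (⊤ : Submodule A F)), a • y = 0 := by
  intro a ha y
  obtain ⟨f, rfl⟩ := Submodule.mkQ_surjective _ y
  rw [← map_smul, Submodule.mkQ_apply, Submodule.Quotient.mk_eq_zero]
  exact Submodule.smul_mem_smul ha trivial

lemma ker_projective {A : Type} [Ring A] {J : Ideal A} {K F : Type} [AddCommGroup K] [Module A K]
    [AddCommGroup F] [Module A F] [IsNoetherian A F] [Module.Projective A F]
    (hrad : J ≤ Ring.jacobson A) (π : F →ₗ[A] K) (hπ : Function.Surjective π)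
    (hcrit : ∀ l, π l = 0 → l ∈ J • (⊤ : Submodule A F) → l ∈ J • LinearMap.ker π)
    (hlift : ∀ (Y Z : Type) [AddCommGroup Y] [Module A Y] [AddCommGroup Z] [Module A Z],
      (∀ a ∈ J, ∀ y : Y, a • y = 0) → ∀ (q : Y →ₗ[A] Z), Function.Surjective q →
      ∀ g : K →ₗ[A] Z, ∃ g' : K →ₗ[A] Y, q.comp g' = g) :
    Module.Projective A K := by
  let JF := J • (⊤ : Submodule A F)
  let JK := J • (⊤ : Submodule A K)
  have hmap : JF.map π = JK := by
    simp only [JF, JK, Submodule.map_smul'', Submodule.map_top, LinearMap.range_eq_top.2 hπ]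
  let q : (F ⧸ JF) →ₗ[A] (K ⧸ JK) := JF.mapQ JK π (Submodule.map_le_iff_le_comap.1 hmap.le)
  have hqmk : ∀ f, q (JF.mkQ f) = JK.mkQ (π f) := fun f => rfl
  have hq : Function.Surjective q := by
    intro z
    obtain ⟨k, rfl⟩ := JK.mkQ_surjective z
    obtain ⟨f, rfl⟩ := hπ k
    exact ⟨JF.mkQ f, rfl⟩
  obtain ⟨g', hg'⟩ := hlift (F ⧸ JF) (K ⧸ JK) killed_quot q hq JK.mkQ
  let L := LinearMap.ker π
  let θ : F →ₗ[A] (F ⧸ JF) := JF.mkQ - g'.comp π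
  let w : L →ₗ[A] (F ⧸ JF) := JF.mkQ.comp L.subtype
  have hθ : ∀ f, θ f ∈ LinearMap.range w := by
    intro f
    have h0 : q (θ f) = 0 := by
      have h1 : q (g' (π f)) = JK.mkQ (π f) := LinearMap.congr_fun hg' (π f)
      show q (JF.mkQ f - g' (π f)) = 0
      rw [map_sub, h1, hqmk, sub_self]
    obtain ⟨f', hf'⟩ := JF.mkQ_surjective (θ f)
    rw [← hf'] at h0 ⊢
    rw [hqmk, Submodule.mkQ_apply, Submodule.Quotient.mk_eq_zero, ← hmap] at h0
    obtain ⟨j, hj, hjf⟩ := h0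
    refine ⟨⟨f' - j, by rw [LinearMap.mem_ker, map_sub, hjf, sub_self]⟩, ?_⟩
    show JF.mkQ (f' - j) = JF.mkQ f'
    rw [map_sub, (Submodule.Quotient.mk_eq_zero JF).2 hj |> (fun h => (h : JF.mkQ j = 0)), sub_zero]
  obtain ⟨ρ, hρ⟩ := Module.projective_lifting_property w.rangeRestrict
    (θ.codRestrict (LinearMap.range w) hθ) (LinearMap.surjective_rangeRestrict w)
  have hρ' : ∀ f, JF.mkQ (ρ f : F) = θ f := fun f =>
    congrArg Subtype.val (LinearMap.congr_fun hρ f)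
  let σ : L →ₗ[A] L := ρ.comp L.subtype
  have hσ : ∀ l : L, l - σ l ∈ J • (⊤ : Submodule A L) := by
    intro l
    have h1 : ((l - σ l : L) : F) ∈ JF := by
      rw [← Submodule.Quotient.mk_eq_zero, ← Submodule.mkQ_apply]
      show JF.mkQ ((l : F) - (ρ l : F)) = 0
      rw [map_sub, hρ']
      show JF.mkQ (l : F) - (JF.mkQ (l : F) - g' (π l)) = 0
      rw [show π l = 0 from l.2, map_zero, sub_zero, sub_self]
    exact mem_smul_ker L _ (hcrit _ (l - σ l).2 h1) (l - σ l).2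
  have hσs : Function.Surjective σ := by
    rw [← LinearMap.range_eq_top]
    have hfin : (⊤ : Submodule A (L ⧸ LinearMap.range σ)).FG := Module.Finite.fg_top
    have h0 : (⊤ : Submodule A (L ⧸ LinearMap.range σ)) = ⊥ := by
      apply Submodule.FG.eq_bot_of_le_jacobson_smul hfin
      rintro x -
      obtain ⟨l, rfl⟩ := Submodule.mkQ_surjective _ x
      have h2 : (LinearMap.range σ).mkQ l = (LinearMap.range σ).mkQ (l - σ l) := by
        rw [map_sub, (Submodule.Quotient.mk_eq_zero (LinearMap.range σ)).2 ⟨l, rfl⟩ |>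
          (fun h => (h : (LinearMap.range σ).mkQ (σ l) = 0)), sub_zero]
      rw [h2]
      have h3 : (LinearMap.range σ).mkQ (l - σ l) ∈
          (J • (⊤ : Submodule A L)).map (LinearMap.range σ).mkQ :=
        Submodule.mem_map_of_mem (hσ l)
      rw [Submodule.map_smul''] at h3
      exact Submodule.smul_mono hrad le_top h3
    rw [eq_top_iff]
    rintro l -
    have : (LinearMap.range σ).mkQ l ∈ (⊤ : Submodule A (L ⧸ LinearMap.range σ)) := trivial
    rw [h0, Submodule.mem_bot] at this
    exact (Submodule.Quotient.mk_eq_zero _).1 this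
  have hσi : Function.Injective σ :=
    IsNoetherian.injective_of_surjective_endomorphism σ hσs
  let e : L ≃ₗ[A] L := LinearEquiv.ofBijective σ ⟨hσi, hσs⟩
  let a : F →ₗ[A] F := LinearMap.id - L.subtype.comp (e.symm.toLinearMap.comp ρ)
  obtain ⟨s, hs⟩ := factor_surj π hπ a (by
    intro x hx
    have : e.symm (ρ x) = ⟨x, hx⟩ := by
      rw [LinearEquiv.symm_apply_eq]; rfl
    show x - (e.symm (ρ x) : F) = 0
    rw [this, sub_self])
  refine Module.Projective.of_split s π ?_
  ext k
  obtain ⟨f, rfl⟩ := hπ k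
  show π (s (π f)) = π f
  rw [hs]
  show π (f - (e.symm (ρ f) : F)) = π f
  rw [map_sub, show π (e.symm (ρ f) : F) = 0 from (e.symm (ρ f)).2, sub_zero]
end TauAux5

section TauAux6

/-- integer valued length -/
noncomputable def len (R : Type) [CommRing R] (H : Type) [AddCommGroup H] [Module R H] : ℤ :=
  ((Module.length R H).toNat : ℤ)

section
variable {R : Type} [CommRing R] [IsArtinianRing R]
variable {H1 H2 H3 : Type} [AddCommGroup H1] [Module R H1] [AddCommGroup H2] [Module R H2]
  [AddCommGroup H3] [Module R H3]

lemma len_exact [Module.Finite R H1] [Module.Finite R H3] (α : H1 →ₗ[R] H2) (β : H2 →ₗ[R] H3)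
    (hα : Function.Injective α) (hβ : Function.Surjective β) (h : Function.Exact α β) :
    len R H2 = len R H1 + len R H3 := by
  unfold len
  rw [Module.length_eq_add_of_exact α β hα hβ h,
    ENat.toNat_add Module.length_ne_top Module.length_ne_top]
  push_cast; rfl

lemma len_equiv (e : H1 ≃ₗ[R] H2) : len R H1 = len R H2 := by
  unfold len; rw [e.length_eq]

lemma len_zero [Subsingleton H1] : len R H1 = 0 := by
  unfold len; rw [Module.length_eq_zero_iff.2 inferInstance]; rfl

lemma len_pos [Nontrivial H1] [Module.Finite R H1] : 0 < len R H1 := by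
  unfold len
  have h := Module.length_pos (R := R) (M := H1)
  have h2 : Module.length R H1 ≠ ⊤ := Module.length_ne_top
  have : (Module.length R H1).toNat ≠ 0 := by
    intro h0
    rw [ENat.toNat_eq_zero] at h0
    rcases h0 with h0 | h0
    · exact h.ne' h0
    · exact h2 h0
  omega

lemma len_four [Module.Finite R H1] [Module.Finite R H2] [Module.Finite R H3]
    (α : H1 →ₗ[R] H2) (β : H2 →ₗ[R] H3)
    (hα : Function.Injective α) (h : Function.Exact α β) :
    len R H3 - len R H2 + len R H1 = len R (H3 ⧸ LinearMap.range β) := by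
  have h1 := len_exact α β.rangeRestrict hα β.surjective_rangeRestrict (by
    intro x
    rw [← h x, ← Subtype.coe_inj]; rfl)
  have h2 := len_exact (LinearMap.range β).subtype (LinearMap.range β).mkQ
    (Submodule.subtype_injective _) (Submodule.mkQ_surjective _) (by
      intro x; simp)
  linarith
end

section
variable {R A : Type} [CommRing R] [IsArtinianRing R] [Ring A] [Algebra R A]

lemma hom_finite (M X : Type) [AddCommGroup M] [Module A M] [Module.Finite A M]
    [AddCommGroup X] [Module A X] [Module R X] [IsScalarTower R A X] [Module.Finite R X] :
    Module.Finite R (M →ₗ[A] X) := by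
  obtain ⟨n, s, hs⟩ := Module.Finite.exists_fin (R := A) (M := M)
  let ev : (M →ₗ[A] X) →ₗ[R] (Fin n → X) :=
    { toFun := fun f i => f (s i)
      map_add' := fun f g => rfl
      map_smul' := fun r f => rfl }
  refine Module.Finite.of_injective ev ?_
  intro f g hfg
  apply LinearMap.ext_on_range hs
  intro i
  exact congrFun hfg i

variable {M X Y Z : Type} [AddCommGroup M] [Module A M] [Module.Finite A M]
  [AddCommGroup X] [Module A X] [Module R X] [IsScalarTower R A X] [Module.Finite R X]
  [AddCommGroup Y] [Module A Y] [Module R Y] [IsScalarTower R A Y] [Module.Finite R Y]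
  [AddCommGroup Z] [Module A Z] [Module R Z] [IsScalarTower R A Z] [Module.Finite R Z]

/-- postcomposition -/
def postc (R : Type) {A : Type} [CommRing R] [Ring A] [Algebra R A]
    (M : Type) {Y Z : Type} [AddCommGroup M] [Module A M]
    [AddCommGroup Y] [Module A Y] [Module R Y] [IsScalarTower R A Y]
    [AddCommGroup Z] [Module A Z] [Module R Z] [IsScalarTower R A Z]
    (q : Y →ₗ[A] Z) : (M →ₗ[A] Y) →ₗ[R] (M →ₗ[A] Z) where
  toFun f := q.comp f
  map_add' f g := LinearMap.comp_add _ _ _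
  map_smul' r f := by
    ext m
    show q (r • f m) = r • q (f m)
    rw [← algebraMap_smul A r (f m), map_smul, algebraMap_smul]

/-- precomposition -/
def prec (R : Type) {A : Type} [CommRing R] [Ring A] [Algebra R A]
    {M N : Type} (X : Type) [AddCommGroup M] [Module A M] [AddCommGroup N] [Module A N]
    [AddCommGroup X] [Module A X] [Module R X] [IsScalarTower R A X]
    (q : M →ₗ[A] N) : (N →ₗ[A] X) →ₗ[R] (M →ₗ[A] X) where
  toFun f := f.comp q
  map_add' f g := rfl
  map_smul' r f := rfl

lemma len_hom_equiv (e : Y ≃ₗ[A] Z) : len R (M →ₗ[A] Y) = len R (M →ₗ[A] Z) := by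
  refine len_equiv (LinearEquiv.ofBijective (postc R M e.toLinearMap) ⟨?_, ?_⟩)
  · intro f g h
    ext m
    exact e.injective (LinearMap.congr_fun h m)
  · intro f
    refine ⟨e.symm.toLinearMap.comp f, ?_⟩
    ext m
    exact e.apply_symm_apply _

lemma len_hom_exact (q : Y →ₗ[A] Z) (N : Submodule A Y) (hN : LinearMap.ker q = N)
    (hM : ∀ g : M →ₗ[A] Z, ∃ g' : M →ₗ[A] Y, q.comp g' = g) :
    len R (M →ₗ[A] Y) = len R (M →ₗ[A] N) + len R (M →ₗ[A] Z) := by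
  subst hN
  have : IsNoetherian R Y := inferInstance
  have : Module.Finite R (LinearMap.ker q) :=
    Module.Finite.of_injective ((LinearMap.ker q).subtype.restrictScalars R)
      (Submodule.subtype_injective _)
  have := hom_finite (R := R) (A := A) M (LinearMap.ker q)
  have := hom_finite (R := R) (A := A) M Z
  refine len_exact (postc R M (LinearMap.ker q).subtype) (postc R M q) ?_ hM ?_
  · intro f g h
    ext m
    exact LinearMap.congr_fun h m
  · intro f
    constructor
    · intro h
      exact ⟨f.codRestrict _ (fun m => LinearMap.congr_fun h m), by ext m; rfl⟩
    · rintro ⟨g, rfl⟩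
      ext m
      exact (g m).2

lemma len_hom_pres {P N : Type} [AddCommGroup P] [Module A P] [Module.Finite A P]
    [AddCommGroup N] [Module A N] [Module.Finite A N]
    (p : P →ₗ[A] N) (hp : Function.Surjective p) [Module.Finite A (LinearMap.ker p)]
    (hM : ∀ g : LinearMap.ker p →ₗ[A] X, ∃ e : P →ₗ[A] X, ∀ k : LinearMap.ker p, e k = g k) :
    len R (P →ₗ[A] X) = len R (N →ₗ[A] X) + len R (LinearMap.ker p →ₗ[A] X) := by
  have := hom_finite (R := R) (A := A) N X
  have := hom_finite (R := R) (A := A) (LinearMap.ker p) X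
  refine len_exact (prec R X p) (prec R X (LinearMap.ker p).subtype) ?_ ?_ ?_
  · intro f g h
    ext m
    obtain ⟨x, rfl⟩ := hp m
    exact LinearMap.congr_fun h x
  · intro g
    obtain ⟨e, he⟩ := hM g
    exact ⟨e, LinearMap.ext he⟩
  · intro f
    constructor
    · intro h
      obtain ⟨g, hg⟩ := factor_surj p hp f (fun x hx => LinearMap.congr_fun h ⟨x, hx⟩)
      exact ⟨g, LinearMap.ext hg⟩
    · rintro ⟨g, rfl⟩
      ext k
      show g (p k) = 0
      rw [show p k = 0 from k.2, map_zero]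
end

section
variable {A : Type} [Ring A] {M : Type} [AddCommGroup M] [Module A M]

lemma isIndec_compl (h : isIndec A M) (U V : Submodule A M) (hUV : IsCompl U V) :
    U = ⊥ ∨ V = ⊥ := by
  have := h.2 U V ⟨(Submodule.prodEquivOfIsCompl U V hUV).symm⟩
  simpa only [Submodule.subsingleton_iff_eq_bot] using this

lemma end_local_one [IsNoetherian A M] [IsArtinian A M] (h : isIndec A M) (f : Module.End A M) :
    IsUnit f ∨ IsUnit (1 - f) := by
  obtain ⟨n, hn0, hn⟩ := ((Filter.eventually_gt_atTop 0).and
    f.eventually_isCompl_ker_pow_range_pow).exists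
  rcases isIndec_compl h _ _ hn with h1 | h1
  · left
    have h2 : LinearMap.range (f ^ n) = ⊤ := by
      have := hn.sup_eq_top
      rwa [h1, bot_sup_eq] at this
    have : IsUnit (f ^ n) := by
      rw [Module.End.isUnit_iff]
      exact ⟨LinearMap.ker_eq_bot.1 h1, LinearMap.range_eq_top.1 h2⟩
    exact (isUnit_pow_iff hn0.ne').1 this
  · right
    have : f ^ n = 0 := LinearMap.range_eq_bot.1 h1
    exact IsNilpotent.isUnit_one_sub ⟨n, this⟩

lemma end_local [IsNoetherian A M] [IsArtinian A M] (h : isIndec A M) (f g : Module.End A M)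
    (hu : IsUnit (f + g)) : IsUnit f ∨ IsUnit g := by
  obtain ⟨u, hu⟩ := hu
  have h1 : (1 : Module.End A M) - ↑u⁻¹ * f = ↑u⁻¹ * g := by
    rw [sub_eq_iff_eq_add, ← mul_add, add_comm g f, ← hu, Units.inv_mul]
  rcases end_local_one h (↑u⁻¹ * f) with h2 | h2
  · left; rwa [Units.isUnit_units_mul] at h2
  · right; rw [h1] at h2; rwa [Units.isUnit_units_mul] at h2

/-- A split epi from an indecomposable to a nonzero module is an isomorphism. -/
lemma split_epi_iso {N : Type} [AddCommGroup N] [Module A N] [Nontrivial N] (h : isIndec A M)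
    (f : M →ₗ[A] N) (s : N →ₗ[A] M) (hfs : ∀ x, f (s x) = x) : Nonempty (M ≃ₗ[A] N) := by
  have hc : IsCompl (LinearMap.ker f) (LinearMap.range s) := by
    rw [isCompl_iff, Submodule.disjoint_def, codisjoint_iff, eq_top_iff]
    constructor
    · rintro _ hx ⟨y, rfl⟩
      rw [LinearMap.mem_ker, hfs] at hx
      rw [hx, map_zero]
    · rintro x -
      refine Submodule.mem_sup.2 ⟨x - s (f x), ?_, s (f x), ⟨_, rfl⟩, sub_add_cancel _ _⟩
      rw [LinearMap.mem_ker, map_sub, hfs, sub_self]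
  rcases isIndec_compl h _ _ hc with h1 | h1
  · exact ⟨LinearEquiv.ofBijective f ⟨LinearMap.ker_eq_bot.1 h1, fun x => ⟨s x, hfs x⟩⟩⟩
  · exfalso
    obtain ⟨x, hx⟩ := exists_ne (0 : N)
    apply hx
    have : s x ∈ LinearMap.range s := ⟨x, rfl⟩
    rw [h1, Submodule.mem_bot] at this
    rw [← hfs x, this, map_zero]
end
end TauAux6

section TauAux7
variable {R A : Type} [CommRing R] [IsArtinianRing R] [Ring A] [Algebra R A]

/-- combination of maps -/
def comb {A : Type} [Ring A] {T N : Type} [AddCommGroup T] [Module A T] [AddCommGroup N]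
    [Module A N] {m : ℕ} (g : Fin m → (T →ₗ[A] N)) : (Fin m → T) →ₗ[A] N :=
  ∑ k, (g k).comp (LinearMap.proj k)

lemma comb_apply {A : Type} [Ring A] {T N : Type} [AddCommGroup T] [Module A T] [AddCommGroup N]
    [Module A N] {m : ℕ} (g : Fin m → (T →ₗ[A] N)) (x : Fin m → T) :
    comb g x = ∑ k, g k (x k) := by
  simp [comb]

lemma fg_gens {H : Type} [AddCommGroup H] [Module R H] [Module.Finite R H] (S : Submodule R H) :
    ∃ (m : ℕ) (g : Fin m → H), (∀ k, g k ∈ S) ∧ ∀ x ∈ S, ∃ c : Fin m → R, ∑ k, c k • g k = x := by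
  have hfg : S.FG := IsNoetherian.noetherian S
  obtain ⟨m, g, hg⟩ := Submodule.fg_iff_exists_fin_generating_family.1 hfg
  refine ⟨m, g, fun k => hg ▸ Submodule.subset_span ⟨k, rfl⟩, fun x hx => ?_⟩
  rw [← hg] at hx
  exact (Submodule.mem_span_range_iff_exists_fun R).1 hx

/-- radical maps -/
def radHom (R : Type) {A : Type} [CommRing R] [Ring A] [Algebra R A] (T N : Type)
    [AddCommGroup T] [Module A T] [AddCommGroup N] [Module A N] [Module R N]
    [IsScalarTower R A N] [IsNoetherian A N] [IsArtinian A N] (h : isIndec A N) :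
    Submodule R (T →ₗ[A] N) where
  carrier := {f | ∀ s : N →ₗ[A] T, ¬ IsUnit (f.comp s : Module.End A N)}
  zero_mem' := fun s hu => by
    have := h.1
    rw [LinearMap.zero_comp] at hu
    exact not_isUnit_zero hu
  add_mem' := fun {f g} hf hg s hu => by
    rw [LinearMap.add_comp] at hu
    rcases end_local h _ _ hu with h1 | h1
    · exact hf s h1
    · exact hg s h1
  smul_mem' := fun r f hf s hu => by
    apply hf s
    have h1 : ((r • f).comp s : Module.End A N) =
        (r • (1 : Module.End A N)) * (f.comp s : Module.End A N) := by
      ext x; rfl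
    have h2 : ((r • f).comp s : Module.End A N) =
        (f.comp s : Module.End A N) * (r • (1 : Module.End A N)) := by
      ext x
      show r • f (s x) = f (s (r • x))
      rw [← algebraMap_smul A r x, map_smul, map_smul, algebraMap_smul]
    rw [h1] at hu h2
    exact ((Commute.isUnit_mul_iff h2).1 hu).2

lemma ar_seq [Module.Finite R A] (T N : Type) [AddCommGroup T] [Module A T] [Module R T]
    [IsScalarTower R A T] [Module.Finite R T] [AddCommGroup N] [Module A N] [Module R N]
    [IsScalarTower R A N] [Module.Finite R N] (hN : isIndec A N)
    (s : N →ₗ[A] T) (r : T →ₗ[A] N) (hrs : r.comp s = LinearMap.id) :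
    ∃ (m : ℕ) (W : Submodule A (Fin m → T)), facP A T W ∧
      0 < len R (N →ₗ[A] N) - len R (N →ₗ[A] (Fin m → T)) + len R (N →ₗ[A] W) ∧
      ∀ (M : Type) [AddCommGroup M] [Module A M] [Module.Finite A M], isIndec A M →
        ¬ Nonempty (M ≃ₗ[A] N) →
        (∃ (s' : M →ₗ[A] T) (r' : T →ₗ[A] M), r'.comp s' = LinearMap.id) →
        len R (M →ₗ[A] N) - len R (M →ₗ[A] (Fin m → T)) + len R (M →ₗ[A] W) = 0 := by
  have : IsArtinianRing A := IsArtinianRing.of_finite R A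
  have : Module.Finite A N := Module.Finite.of_restrictScalars_finite R A N
  have : Module.Finite A T := Module.Finite.of_restrictScalars_finite R A T
  have := hom_finite (R := R) (A := A) T N
  obtain ⟨m, g, hg, hgen⟩ := fg_gens (R := R) (radHom R T N hN)
  have := hom_finite (R := R) (A := A) T (Fin m → T)
  obtain ⟨l, u, hu, hugen⟩ := fg_gens (R := R) (LinearMap.ker (postc R T (comb g)))
  let W := LinearMap.range (comb u)
  have hWG : ∀ w ∈ W, comb g w = 0 := by
    rintro _ ⟨x, rfl⟩
    rw [comb_apply u, map_sum]
    exact Finset.sum_eq_zero fun k _ => LinearMap.congr_fun (hu k) (x k)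
  have : Module.Finite R W :=
    Module.Finite.of_injective (W.subtype.restrictScalars R) (Submodule.subtype_injective _)
  have key : ∀ (M : Type) [AddCommGroup M] [Module A M] [Module.Finite A M],
      (∃ (s' : M →ₗ[A] T) (r' : T →ₗ[A] M), r'.comp s' = LinearMap.id) →
      len R (M →ₗ[A] N) - len R (M →ₗ[A] (Fin m → T)) + len R (M →ₗ[A] W) =
        len R ((M →ₗ[A] N) ⧸ LinearMap.range (postc R M (comb g))) := by
    rintro M _ _ _ ⟨s', r', hsr⟩
    have := hom_finite (R := R) (A := A) M (Fin m → T)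
    have := hom_finite (R := R) (A := A) M N
    have := hom_finite (R := R) (A := A) M W
    refine len_four (postc R M W.subtype) (postc R M (comb g)) ?_ ?_
    · intro f g h
      ext x : 1
      exact Subtype.ext (LinearMap.congr_fun h x)
    · intro f
      constructor
      · intro h
        obtain ⟨c, hc⟩ := hugen (f.comp r') (by
          rw [LinearMap.mem_ker]
          ext x
          exact LinearMap.congr_fun h (r' x))
        refine ⟨f.codRestrict W fun x => ?_, by ext x : 1; rfl⟩
        have h1 : f x = (f.comp r') (s' x) := by
          show f x = f ((r'.comp s') x)
          rw [hsr]; rfl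
        rw [h1, ← hc]
        refine ⟨fun k => c k • s' x, ?_⟩
        rw [comb_apply, LinearMap.sum_apply]
        refine Finset.sum_congr rfl fun k _ => ?_
        rw [LinearMap.smul_apply, ← algebraMap_smul A (c k) (s' x), map_smul, algebraMap_smul]
      · rintro ⟨f', rfl⟩
        ext x
        exact hWG _ (f' x).2
  refine ⟨m, W, ⟨l, (comb u).rangeRestrict, LinearMap.surjective_rangeRestrict _⟩, ?_, ?_⟩
  · rw [key N ⟨s, r, hrs⟩]
    have := hom_finite (R := R) (A := A) N N
    have : Nontrivial ((N →ₗ[A] N) ⧸ LinearMap.range (postc R N (comb g))) := by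
      rw [Submodule.Quotient.nontrivial_iff]
      intro htop
      have : (LinearMap.id : N →ₗ[A] N) ∈ LinearMap.range (postc R N (comb g)) := by
        rw [htop]; trivial
      obtain ⟨f, hf⟩ := this
      have hsum : ∀ t : Finset (Fin m), ¬ IsUnit
          (∑ k ∈ t, ((g k).comp ((LinearMap.proj k).comp f)) : Module.End A N) := by
        intro t
        induction t using Finset.induction_on with
        | empty =>
          have := hN.1
          rw [Finset.sum_empty]
          exact not_isUnit_zero
        | insert k t hk ih =>
          rw [Finset.sum_insert hk]
          intro hu
          rcases end_local hN _ _ hu with h1 | h1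
          · exact hg k _ h1
          · exact ih h1
      apply hsum Finset.univ
      have : (∑ k, ((g k).comp ((LinearMap.proj k).comp f)) : N →ₗ[A] N) = LinearMap.id := by
        rw [← hf]
        ext x
        rw [LinearMap.sum_apply]
        exact (comb_apply g (f x)).symm
      rw [this]
      exact isUnit_one
    exact len_pos
  · rintro M _ _ _ hM hne ⟨s', r', hsr⟩
    rw [key M ⟨s', r', hsr⟩]
    have : Subsingleton ((M →ₗ[A] N) ⧸ LinearMap.range (postc R M (comb g))) := by
      rw [Submodule.Quotient.subsingleton_iff, eq_top_iff]
      rintro f -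
      have hmem : f.comp r' ∈ radHom R T N hN := by
        rintro σ ⟨w, hw⟩
        apply hne
        have := hN.1
        have hw2 : ((w * w⁻¹ : (Module.End A N)ˣ) : Module.End A N) = 1 := by
          rw [mul_inv_cancel]; rfl
        refine split_epi_iso hM f ((r'.comp σ).comp (↑w⁻¹ : Module.End A N)) fun x => ?_
        rw [Units.val_mul, hw] at hw2
        exact LinearMap.congr_fun hw2 x
      obtain ⟨c, hc⟩ := hgen _ hmem
      refine ⟨LinearMap.pi fun k => c k • s', ?_⟩
      ext x
      have h1 : f x = (f.comp r') (s' x) := by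
        show f x = f ((r'.comp s') x)
        rw [hsr]; rfl
      rw [h1, ← hc]
      show comb g _ = _
      rw [comb_apply, LinearMap.sum_apply]
      refine Finset.sum_congr rfl fun k _ => ?_
      show g k (c k • s' x) = c k • g k (s' x)
      rw [← algebraMap_smul A (c k) (s' x), map_smul, algebraMap_smul]
    exact len_zero
end TauAux7

section TauAux8

/-- difference of Hom lengths -/
noncomputable def phi (R : Type) {A : Type} [CommRing R] [Ring A] [Algebra R A] (P K : Type)
    [AddCommGroup P] [Module A P] [AddCommGroup K] [Module A K]
    (X : Type) [AddCommGroup X] [Module A X] [Module R X] [IsScalarTower R A X] : ℤ :=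
  len R (P →ₗ[A] X) - len R (K →ₗ[A] X)

section
variable {R A : Type} [CommRing R] [IsArtinianRing R] [Ring A] [Algebra R A]
  (P K : Type) [AddCommGroup P] [Module A P] [AddCommGroup K] [Module A K]

lemma phi_zero (X : Type) [AddCommGroup X] [Module A X] [Module R X] [IsScalarTower R A X]
    [Subsingleton X] : phi R (A := A) P K X = 0 := by
  unfold phi
  rw [len_zero, len_zero, sub_self]

lemma phi_equiv {X Y : Type} [AddCommGroup X] [Module A X] [Module R X] [IsScalarTower R A X]
    [AddCommGroup Y] [Module A Y] [Module R Y] [IsScalarTower R A Y]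
    [Module.Finite A P] [Module.Finite A K] [Module.Finite R X] [Module.Finite R Y]
    (e : X ≃ₗ[A] Y) : phi R (A := A) P K X = phi R (A := A) P K Y := by
  unfold phi
  rw [len_hom_equiv (R := R) (M := P) e, len_hom_equiv (R := R) (M := K) e]

lemma phi_add {X : Type} [AddCommGroup X] [Module A X] [Module R X] [IsScalarTower R A X]
    [Module.Finite A P] [Module.Finite A K] [Module.Finite R X] (N0 : Submodule A X)
    (h1 : ∀ g : P →ₗ[A] (X ⧸ N0), ∃ g' : _ →ₗ[A] X, N0.mkQ.comp g' = g)
    (h2 : ∀ g : K →ₗ[A] (X ⧸ N0), ∃ g' : _ →ₗ[A] X, N0.mkQ.comp g' = g) :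
    phi R (A := A) P K X = phi R (A := A) P K N0 + phi R (A := A) P K (X ⧸ N0) := by
  have fQ : Module.Finite R (X ⧸ N0) :=
    Module.Finite.of_surjective (N0.mkQ.restrictScalars R) (Submodule.mkQ_surjective _)
  have e1 := len_hom_exact (R := R) N0.mkQ N0 (Submodule.ker_mkQ _) h1
  have e2 := len_hom_exact (R := R) N0.mkQ N0 (Submodule.ker_mkQ _) h2
  unfold phi
  linarith
end

lemma quot_killed {A : Type} [Ring A] {J : Ideal A} {X : Type} [AddCommGroup X] [Module A X]
    (hk : ∀ b ∈ J, ∀ y : X, b • y = 0) (N0 : Submodule A X) :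
    ∀ b ∈ J, ∀ y : X ⧸ N0, b • y = 0 := by
  intro b hb y
  obtain ⟨x, rfl⟩ := N0.mkQ_surjective y
  have h := N0.mkQ.map_smul b x
  rw [← h, hk b hb x, map_zero]

lemma vanish {R A : Type} [CommRing R] [IsArtinianRing R] [Ring A] [Algebra R A]
    [Module.Finite R A] {J : Ideal A} {ι κ : Type} [Fintype ι] (P K : ι → Type)
    [∀ i, AddCommGroup (P i)] [∀ i, Module A (P i)] [∀ i, AddCommGroup (K i)]
    [∀ i, Module A (K i)] [∀ i, Module.Finite A (P i)] [∀ i, Module.Finite A (K i)]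
    [∀ i, Module.Projective A (P i)]
    (hlift : ∀ i, ∀ (Y Z : Type) [AddCommGroup Y] [Module A Y] [AddCommGroup Z] [Module A Z],
      (∀ a ∈ J, ∀ y : Y, a • y = 0) → ∀ (q : Y →ₗ[A] Z), Function.Surjective q →
      ∀ g : K i →ₗ[A] Z, ∃ g' : K i →ₗ[A] Y, q.comp g' = g)
    (S : κ → Submodule A A)
    (hS : ∀ m : Submodule A A, IsCoatom m → (∀ a ∈ J, ∀ y : A ⧸ m, a • y = 0) →
      ∃ k, Nonempty ((A ⧸ m) ≃ₗ[A] (A ⧸ S k)))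
    (a : ι → ℚ) (hS0 : ∀ k, ∑ i, a i * (phi R (A := A) (P i) (K i) (A ⧸ S k) : ℚ) = 0)
    (X : Type) [AddCommGroup X] [Module A X] (hX : IsFiniteLength A X) :
    ∀ [Module R X] [IsScalarTower R A X] [Module.Finite R X],
        (∀ b ∈ J, ∀ y : X, b • y = 0) →
        ∑ i, a i * (phi R (A := A) (P i) (K i) X : ℚ) = 0 := by
  induction hX with
  | @of_subsingleton X _ _ _ =>
    intro _ _ _ hk
    refine Finset.sum_eq_zero fun i _ => ?_
    rw [phi_zero]; simp
  | @of_simple_quotient X _ _ N0 _ hN0 ih =>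
    intro _ _ _ hk
    have fN : Module.Finite R N0 :=
      Module.Finite.of_injective (N0.subtype.restrictScalars R) (Submodule.subtype_injective _)
    have fQ : Module.Finite R (X ⧸ N0) :=
      Module.Finite.of_surjective (N0.mkQ.restrictScalars R) (Submodule.mkQ_surjective _)
    have h1 := ih (fun b hb y => Subtype.ext (hk b hb y))
    have hkq := quot_killed hk N0
    have hadd : ∀ i, phi R (A := A) (P i) (K i) X =
        phi R (A := A) (P i) (K i) N0 + phi R (A := A) (P i) (K i) (X ⧸ N0) := by
      intro i
      exact phi_add (P i) (K i) N0
        (fun g => Module.projective_lifting_property _ g N0.mkQ_surjective)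
        (fun g => hlift i X (X ⧸ N0) hk N0.mkQ N0.mkQ_surjective g)
    have h2 : ∑ i, a i * (phi R (A := A) (P i) (K i) (X ⧸ N0) : ℚ) = 0 := by
      obtain ⟨m, hm, ⟨e⟩⟩ := isSimpleModule_iff_quot_maximal.1 (inferInstance :
        IsSimpleModule A (X ⧸ N0))
      obtain ⟨k, ⟨e'⟩⟩ := hS m hm.out (fun b hb y => by
        apply e.symm.injective
        have h := e.symm.map_smul b y
        rw [h, hkq b hb, map_zero])
      rw [← hS0 k]
      refine Finset.sum_congr rfl fun i _ => ?_
      rw [phi_equiv (R := R) (P i) (K i) (e.trans e')]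
    have : ∑ i, a i * (phi R (A := A) (P i) (K i) X : ℚ) =
        ∑ i, a i * (phi R (A := A) (P i) (K i) N0 : ℚ) +
        ∑ i, a i * (phi R (A := A) (P i) (K i) (X ⧸ N0) : ℚ) := by
      rw [← Finset.sum_add_distrib]
      refine Finset.sum_congr rfl fun i _ => ?_
      rw [hadd]; push_cast; ring
    rw [this, h1, h2, add_zero]

set_option maxHeartbeats 1000000 in
lemma thmN {R A : Type} [CommRing R] [IsArtinianRing R] [Ring A] [Algebra R A] [Module.Finite R A]
    (T : Type) [AddCommGroup T] [Module A T] [Module R T] [IsScalarTower R A T]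
    [Module.Finite R T] (hT : ELift A T T)
    {J : Ideal A} (hJ : ∀ a, a ∈ J ↔ ∀ t : T, a • t = 0)
    {n : ℕ} (v : Fin n → T) (hv : ∀ a : A, (∀ i, a • v i = 0) → a ∈ J)
    {ι κ : Type} [Fintype ι] [Fintype κ] (N : ι → Type) [∀ i, AddCommGroup (N i)]
    [∀ i, Module A (N i)] [∀ i, Module R (N i)] [∀ i, IsScalarTower R A (N i)]
    [∀ i, Module.Finite R (N i)] (hN : ∀ i, isIndec A (N i))
    (hsum : ∀ i, ∃ (s' : N i →ₗ[A] T) (r' : T →ₗ[A] N i), r'.comp s' = LinearMap.id)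
    (hne : ∀ i j, i ≠ j → ¬ Nonempty (N i ≃ₗ[A] N j))
    (S : κ → Submodule A A)
    (hS : ∀ m : Submodule A A, IsCoatom m → (∀ a ∈ J, ∀ y : A ⧸ m, a • y = 0) →
      ∃ k, Nonempty ((A ⧸ m) ≃ₗ[A] (A ⧸ S k))) :
    Fintype.card ι ≤ Fintype.card κ := by
  classical
  have : IsArtinianRing A := IsArtinianRing.of_finite R A
  have hfin : ∀ i, Module.Finite A (N i) :=
    fun i => Module.Finite.of_restrictScalars_finite R A (N i)
  have hEx : ∀ i, ∃ (n : ℕ) (p : (Fin n → A) →ₗ[A] N i), Function.Surjective p :=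
    fun i => Module.Finite.exists_fin' A (N i)
  choose d p hp using hEx
  have hEL : ∀ i, ELift A T (N i) := fun i => by
    obtain ⟨s, r, hrs⟩ := hsum i
    exact hT.summand s r hrs
  let Φ (i : ι) (X : Type) [AddCommGroup X] [Module A X] [Module R X] [IsScalarTower R A X] : ℤ :=
    phi R (A := A) (Fin (d i) → A) (LinearMap.ker (p i)) X
  let vec : ι → (κ → ℚ) := fun i k => (Φ i (A ⧸ S k) : ℚ)
  have hli : LinearIndependent ℚ vec := by
    rw [Fintype.linearIndependent_iff]
    intro a ha
    have hS0 : ∀ k, ∑ i, a i * (Φ i (A ⧸ S k) : ℚ) = 0 := by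
      intro k
      have := congrFun ha k
      simpa [vec, Finset.sum_apply] using this
    have hvan : ∀ (X : Type) [AddCommGroup X] [Module A X], IsFiniteLength A X →
        ∀ [Module R X] [IsScalarTower R A X] [Module.Finite R X],
        (∀ a ∈ J, ∀ y : X, a • y = 0) → ∑ i, a i * (Φ i X : ℚ) = 0 := by
      intro X _ _ hX
      exact vanish (R := R) (J := J) (fun i => (Fin (d i) → A)) (fun i => LinearMap.ker (p i))
        (fun i Y Z _ _ _ _ hk q hq g => lpK hJ v hv (hEL i) (p i) (hp i) hk q hq g) S hS a hS0 X hX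
    have hfac : ∀ (X : Type) [AddCommGroup X] [Module A X] [Module R X] [IsScalarTower R A X]
        [Module.Finite R X], facP A T X → ∑ i, a i * (len R (N i →ₗ[A] X) : ℚ) = 0 := by
      intro X _ _ _ _ _ hX
      have : Module.Finite A X := Module.Finite.of_restrictScalars_finite R A X
      have hl : IsFiniteLength A X :=
        isFiniteLength_iff_isNoetherian_isArtinian.2 ⟨inferInstance, inferInstance⟩
      have h0 := hvan X hl (fun a ha y => by
        obtain ⟨c, f, hf⟩ := hX
        obtain ⟨t, rfl⟩ := hf y
        rw [← f.map_smul]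
        have : a • t = 0 := by ext i; exact (hJ a).1 ha _
        rw [this, map_zero])
      rw [← h0]
      refine Finset.sum_congr rfl fun i _ => ?_
      have := len_hom_pres (R := R) (X := X) (p i) (hp i)
        (fun g => (hEL i).extend (p i) (hp i) hX g)
      have h3 : Φ i X = len R (N i →ₗ[A] X) := by simp only [Φ, phi]; linarith
      rw [h3]
    intro j
    obtain ⟨s, r, hrs⟩ := hsum j
    obtain ⟨m, W, hW, hpos, hzero⟩ := ar_seq (R := R) T (N j) (hN j) s r hrs
    have fW : Module.Finite R W :=
      Module.Finite.of_injective (W.subtype.restrictScalars R) (Submodule.subtype_injective _)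
    have e1 := hfac (N j) ((facP.self T).of_surj r fun x => ⟨s x, LinearMap.congr_fun hrs x⟩)
    have e2 := hfac (Fin m → T) (facP.pi T m)
    have e3 := hfac W hW
    have e4 : ∑ i, a i * ((len R (N i →ₗ[A] N j) - len R (N i →ₗ[A] (Fin m → T)) +
        len R (N i →ₗ[A] W) : ℤ) : ℚ) = 0 := by
      have : ∑ i, a i * ((len R (N i →ₗ[A] N j) - len R (N i →ₗ[A] (Fin m → T)) +
        len R (N i →ₗ[A] W) : ℤ) : ℚ) = ∑ i, a i * (len R (N i →ₗ[A] N j) : ℚ) -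
          ∑ i, a i * (len R (N i →ₗ[A] (Fin m → T)) : ℚ) + ∑ i, a i * (len R (N i →ₗ[A] W) : ℚ) := by
        rw [← Finset.sum_sub_distrib, ← Finset.sum_add_distrib]
        refine Finset.sum_congr rfl fun i _ => ?_
        push_cast; ring
      rw [this, e1, e2, e3]; norm_num
    rw [Finset.sum_eq_single j] at e4
    · rcases mul_eq_zero.1 e4 with h | h
      · exact h
      · exact absurd (by exact_mod_cast h) hpos.ne'
    · intro i _ hij
      rw [hzero (N i) (hN i) (hne i j hij) (hsum i)]
      simp
    · intro h; exact absurd (Finset.mem_univ _) h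
  have := hli.fintype_card_le_finrank
  simpa using this
end TauAux8

section TauAux9

lemma simple_iso_of_ne {A S S' : Type} [Ring A] [AddCommGroup S] [Module A S] [AddCommGroup S']
    [Module A S'] [IsSimpleModule A S] [IsSimpleModule A S'] (f : S →ₗ[A] S') (hf : f ≠ 0) :
    Nonempty (S ≃ₗ[A] S') :=
  ⟨LinearEquiv.ofBijective f (LinearMap.bijective_of_ne_zero hf)⟩

lemma finite_simples {A : Type} [Ring A] (X : Type) [AddCommGroup X] [Module A X]
    (hX : IsFiniteLength A X) : ∃ (n : ℕ) (S : Fin n → Submodule A A),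
      ∀ m : Submodule A A, IsCoatom m → ∀ q : X →ₗ[A] (A ⧸ m), q ≠ 0 →
        ∃ k, Nonempty ((A ⧸ m) ≃ₗ[A] (A ⧸ S k)) := by
  induction hX with
  | @of_subsingleton X _ _ _ =>
    refine ⟨0, fun _ => ⊥, fun m hm q hq => absurd ?_ hq⟩
    ext x
    rw [Subsingleton.elim x 0, map_zero, map_zero]
  | @of_simple_quotient X _ _ N0 _ hN0 ih =>
    obtain ⟨n, S, hS⟩ := ih
    obtain ⟨m0, hm0, ⟨e⟩⟩ := isSimpleModule_iff_quot_maximal.1 (inferInstance :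
        IsSimpleModule A (X ⧸ N0))
    refine ⟨n + 1, Fin.cons m0 S, fun m hm q hq => ?_⟩
    by_cases h0 : q.comp N0.subtype = 0
    · have : IsSimpleModule A (A ⧸ m) := isSimpleModule_iff_isCoatom.2 hm
      obtain ⟨g, hg⟩ := factor_surj N0.mkQ N0.mkQ_surjective q (fun x hx => by
        rw [Submodule.mkQ_apply, Submodule.Quotient.mk_eq_zero] at hx
        exact LinearMap.congr_fun h0 ⟨x, hx⟩)
      have hg0 : g ≠ 0 := by
        rintro rfl
        apply hq
        ext x
        exact (hg x).symm
      obtain ⟨e'⟩ := simple_iso_of_ne g hg0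
      exact ⟨0, ⟨e'.symm.trans e⟩⟩
    · obtain ⟨k, hk⟩ := hS m hm _ h0
      exact ⟨k.succ, hk⟩

lemma proj_cover {A : Type} [Ring A] [IsArtinianRing A] (m : Submodule A A) (hm : IsCoatom m) :
    ∃ N : Submodule A A, isIndec A N ∧
      (∃ (s : N →ₗ[A] A) (r : A →ₗ[A] N), r.comp s = LinearMap.id) ∧
      ∃ q : N →ₗ[A] (A ⧸ m), Function.Surjective q := by
  let C : Set (Submodule A A) := {N | (∃ ρ : A →ₗ[A] A, (∀ x, ρ x ∈ N) ∧ ∀ x ∈ N, ρ x = x) ∧ ¬ N ≤ m}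
  obtain ⟨N, ⟨⟨ρ, hρ1, hρ2⟩, hNm⟩, hmin⟩ := IsArtinian.set_has_minimal C
    ⟨⊤, ⟨LinearMap.id, fun _ => trivial, fun _ _ => rfl⟩, fun h => hm.1 (top_le_iff.1 h)⟩
  have key : ∀ (X Y : Type) [AddCommGroup X] [Module A X] [AddCommGroup Y] [Module A Y]
      (e : N ≃ₗ[A] X × Y), ¬ (∀ x, (e.symm (x, 0) : A) ∈ m) → Subsingleton Y := by
    intro X Y _ _ _ _ e hX
    let i : X →ₗ[A] A := N.subtype.comp (e.symm.toLinearMap.comp (LinearMap.inl A X Y))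
    have hi : ∀ x, i x = (e.symm (x, 0) : A) := fun x => rfl
    let rr : A →ₗ[A] X := (LinearMap.fst A X Y).comp
      (e.toLinearMap.comp (ρ.codRestrict N hρ1))
    have hri : ∀ x, rr (i x) = x := by
      intro x
      have : (ρ.codRestrict N hρ1) (i x) = e.symm (x, 0) :=
        Subtype.ext (hρ2 _ (e.symm (x, 0)).2)
      show (e ((ρ.codRestrict N hρ1) (i x))).1 = x
      rw [this, e.apply_symm_apply]
    have hU : LinearMap.range i ∈ C := by
      refine ⟨⟨i.comp rr, fun x => ⟨rr x, rfl⟩, ?_⟩, ?_⟩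
      · rintro _ ⟨x, rfl⟩
        rw [LinearMap.comp_apply, hri]
      · intro hle
        exact hX fun x => hle ⟨x, rfl⟩
    have hle : LinearMap.range i ≤ N := by
      rintro _ ⟨x, rfl⟩
      exact (e.symm (x, 0)).2
    have heq : LinearMap.range i = N := by
      by_contra hne
      exact hmin _ hU (lt_of_le_of_ne hle hne)
    have hy : ∀ y : Y, y = 0 := by
      intro y
      have : (e.symm (0, y) : A) ∈ LinearMap.range i := by rw [heq]; exact (e.symm (0, y)).2
      obtain ⟨x, hx⟩ := this
      have h1 : e.symm (x, 0) = e.symm (0, y) := Subtype.ext hx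
      exact (congrArg Prod.snd (e.symm.injective h1)).symm
    exact ⟨fun a b => by rw [hy a, hy b]⟩
  refine ⟨N, ⟨?_, ?_⟩, ⟨N.subtype, ρ.codRestrict N hρ1, ?_⟩, m.mkQ.comp N.subtype, ?_⟩
  · rw [Submodule.nontrivial_iff_ne_bot]
    rintro rfl
    exact hNm bot_le
  · rintro X Y _ _ _ _ ⟨e⟩
    by_cases hX : ∀ x, (e.symm (x, 0) : A) ∈ m
    · left
      refine key Y X (e.trans (LinearEquiv.prodComm A X Y)) ?_
      intro hY
      apply hNm
      intro a ha
      have h1 : (⟨a, ha⟩ : N) = e.symm ((e ⟨a, ha⟩).1, 0) + e.symm (0, (e ⟨a, ha⟩).2) := by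
        rw [← map_add, Prod.mk_add_mk, add_zero, zero_add, Prod.mk.eta, e.symm_apply_apply]
      have h2 : a = (e.symm ((e ⟨a, ha⟩).1, 0) : A) + (e.symm (0, (e ⟨a, ha⟩).2) : A) :=
        congrArg Subtype.val h1
      rw [h2]
      exact m.add_mem (hX _) (hY _)
    · right
      exact key X Y e hX
  · ext x
    exact hρ2 x x.2
  · have : IsSimpleModule A (A ⧸ m) := isSimpleModule_iff_isCoatom.2 hm
    apply LinearMap.surjective_of_ne_zero
    intro h0
    apply hNm
    intro a ha
    have := LinearMap.congr_fun h0 ⟨a, ha⟩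
    exact (Submodule.Quotient.mk_eq_zero m).1 this

lemma proj_unique {A P S S' : Type} [Ring A] [AddCommGroup P] [Module A P]
    [IsNoetherian A P] [IsArtinian A P] [Module.Projective A P] (hP : isIndec A P)
    [AddCommGroup S] [Module A S] [AddCommGroup S']
    [Module A S'] [IsSimpleModule A S] [IsSimpleModule A S']
    (q : P →ₗ[A] S) (hq : Function.Surjective q) (q' : P →ₗ[A] S') (hq' : Function.Surjective q') :
    Nonempty (S ≃ₗ[A] S') := by
  have nS : Nontrivial S := IsSimpleModule.nontrivial A S
  have nS' : Nontrivial S' := IsSimpleModule.nontrivial A S'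
  by_cases h0 : q'.comp (LinearMap.ker q).subtype = 0
  · obtain ⟨g, hg⟩ := factor_surj q hq q' (fun x hx => LinearMap.congr_fun h0 ⟨x, hx⟩)
    refine simple_iso_of_ne g ?_
    rintro rfl
    obtain ⟨y, hy⟩ := exists_ne (0 : S')
    obtain ⟨x, rfl⟩ := hq' y
    exact hy (hg x).symm
  · exfalso
    obtain ⟨f, hf⟩ := Module.projective_lifting_property _ q'
      (LinearMap.surjective_of_ne_zero h0)
    have hf' : ∀ x, q' (f x : P) = q' x := fun x => LinearMap.congr_fun hf x
    rcases end_local_one hP ((LinearMap.ker q).subtype.comp f) with h | h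
    · rw [Module.End.isUnit_iff] at h
      obtain ⟨y, hy⟩ := exists_ne (0 : S)
      obtain ⟨x, rfl⟩ := hq y
      obtain ⟨z, rfl⟩ := h.2 x
      exact hy (f z).2
    · rw [Module.End.isUnit_iff] at h
      obtain ⟨y, hy⟩ := exists_ne (0 : S')
      obtain ⟨x, rfl⟩ := hq' y
      obtain ⟨z, rfl⟩ := h.2 x
      apply hy
      show q' (z - (f z : P)) = 0
      rw [map_sub, hf', sub_self]

/-- simple modules up to isomorphism -/
def simpSetoid (A : Type) [Ring A] : Setoid {m : Submodule A A // IsCoatom m} where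
  r X Y := Nonempty ((A ⧸ X.1) ≃ₗ[A] (A ⧸ Y.1))
  iseqv := ⟨fun _ => ⟨LinearEquiv.refl A _⟩, fun ⟨e⟩ => ⟨e.symm⟩, fun ⟨e⟩ ⟨f⟩ => ⟨e.trans f⟩⟩

lemma simp_finite (A : Type) [Ring A] [IsArtinianRing A] : Finite (Quotient (simpSetoid A)) := by
  obtain ⟨n, S, hS⟩ := finite_simples (A := A) A
    (isFiniteLength_iff_isNoetherian_isArtinian.2 ⟨inferInstance, inferInstance⟩)
  have : ∀ c : Quotient (simpSetoid A), ∃ k, Nonempty ((A ⧸ c.out.1) ≃ₗ[A] (A ⧸ S k)) := by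
    intro c
    refine hS _ c.out.2 (Submodule.mkQ _) ?_
    intro h0
    apply c.out.2.1
    rw [← Submodule.ker_mkQ c.out.1, h0, LinearMap.ker_zero]
  choose k hk using this
  refine Finite.of_injective k fun c c' h => ?_
  obtain ⟨e⟩ := hk c
  obtain ⟨e'⟩ := hk c'
  rw [← Quotient.out_eq c, ← Quotient.out_eq c']
  rw [h] at e
  exact Quotient.sound ⟨e.trans e'.symm⟩

/-- isomorphism classes of indecomposable summands -/
abbrev indCls (A : Type) [Ring A] (M : Type) [AddCommGroup M] [Module A M] : Type 1 :=
  Quotient (isoSetoid A (fun N => isIndec A ↥N ∧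
    ∃ (s : ↥N →ₗ[A] M) (r : M →ₗ[A] ↥N), r.comp s = LinearMap.id))

lemma simp_to_cls (A : Type) [Ring A] [IsArtinianRing A] :
    ∃ g : Quotient (simpSetoid A) → indCls A A, Function.Injective g := by
  have h := fun c : Quotient (simpSetoid A) => proj_cover c.out.1 c.out.2
  choose N hN hs q hq using h
  refine ⟨fun c => Quotient.mk _ ⟨ModuleCat.of A (N c), hN c, hs c⟩, fun c c' hcc => ?_⟩
  obtain ⟨e⟩ : Nonempty (N c ≃ₗ[A] N c') := Quotient.exact hcc
  have : IsSimpleModule A (A ⧸ c.out.1) := isSimpleModule_iff_isCoatom.2 c.out.2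
  have : IsSimpleModule A (A ⧸ c'.out.1) := isSimpleModule_iff_isCoatom.2 c'.out.2
  obtain ⟨s, r, hrs⟩ := hs c
  have : Module.Projective A (N c) := Module.Projective.of_split s r hrs
  rw [← Quotient.out_eq c, ← Quotient.out_eq c']
  exact Quotient.sound (proj_unique (hN c) (q c) (hq c) ((q c').comp e.toLinearMap)
    ((hq c').comp e.surjective))

lemma count_le {R A : Type} [CommRing R] [IsArtinianRing R] [Ring A] [Algebra R A]
    [Module.Finite R A]
    (T : Type) [AddCommGroup T] [Module A T] [Module R T] [IsScalarTower R A T]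
    [Module.Finite R T] (hT : ELift A T T)
    {J : Ideal A} (hJ : ∀ a, a ∈ J ↔ ∀ t : T, a • t = 0)
    {n : ℕ} (v : Fin n → T) (hv : ∀ a : A, (∀ i, a • v i = 0) → a ∈ J)
    {κ : Type} [Fintype κ] (S : κ → Submodule A A)
    (hS : ∀ m : Submodule A A, IsCoatom m → (∀ a ∈ J, ∀ y : A ⧸ m, a • y = 0) →
      ∃ k, Nonempty ((A ⧸ m) ≃ₗ[A] (A ⧸ S k))) :
    Finite (indCls A T) ∧ Nat.card (indCls A T) ≤ Fintype.card κ := by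
  have key : ∀ F : Finset (indCls A T), F.card ≤ Fintype.card κ := by
    intro F
    let o : Fin F.card → indCls A T := fun i => (F.equivFin.symm i).1
    have ho : Function.Injective o := fun i j h => F.equivFin.symm.injective (Subtype.ext h)
    let N : Fin F.card → Type := fun i => ((o i).out.1 : ModuleCat A)
    let i1 : ∀ i, AddCommGroup (N i) := fun i => ((o i).out.1).isAddCommGroup
    let i2 : ∀ i, Module A (N i) := fun i => ((o i).out.1).isModule
    let i3 : ∀ i, Module R (N i) := fun i => Module.compHom (N i) (algebraMap R A)
    have i4 : ∀ i, IsScalarTower R A (N i) := fun i => ⟨fun r a x => by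
      show (r • a) • x = algebraMap R A r • (a • x)
      rw [Algebra.smul_def, mul_smul]⟩
    have hs : ∀ i, ∃ (s' : N i →ₗ[A] T) (r' : T →ₗ[A] N i), r'.comp s' = LinearMap.id :=
      fun i => (o i).out.2.2
    have i5 : ∀ i, Module.Finite R (N i) := fun i => by
      obtain ⟨s, r, hrs⟩ := hs i
      exact Module.Finite.of_surjective (r.restrictScalars R)
        (fun x => ⟨s x, LinearMap.congr_fun hrs x⟩)
    have := thmN (R := R) T hT hJ v hv N (fun i => (o i).out.2.1) hs (fun i j hij hiso => by
      apply hij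
      apply ho
      rw [← Quotient.out_eq (o i), ← Quotient.out_eq (o j)]
      exact Quotient.sound hiso) S hS
    simpa using this
  have hfin : Finite (indCls A T) := by
    by_contra hinf
    rw [not_finite_iff_infinite] at hinf
    obtain ⟨F, hF⟩ := Infinite.exists_subset_card_eq (indCls A T) (Fintype.card κ + 1)
    have := key F
    omega
  refine ⟨hfin, ?_⟩
  have := Fintype.ofFinite (indCls A T)
  rw [Nat.card_eq_fintype_card]
  exact key Finset.univ

lemma rad_of_count {R A : Type} [CommRing R] [IsArtinianRing R] [Ring A] [Algebra R A]
    [Module.Finite R A]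
    (T : Type) [AddCommGroup T] [Module A T] [Module R T] [IsScalarTower R A T]
    [Module.Finite R T] (hT : ELift A T T)
    {J : Ideal A} (hJ : ∀ a, a ∈ J ↔ ∀ t : T, a • t = 0)
    {n : ℕ} (v : Fin n → T) (hv : ∀ a : A, (∀ i, a • v i = 0) → a ∈ J)
    (hnum : numIndec A T = numIndec A A) : J ≤ Ring.jacobson A := by
  classical
  have : IsArtinianRing A := IsArtinianRing.of_finite R A
  have := simp_finite A
  have := Fintype.ofFinite (Quotient (simpSetoid A))
  have hmk : ∀ (m : Submodule A A) (hm : IsCoatom m),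
      Nonempty ((A ⧸ m) ≃ₗ[A] (A ⧸ (Quotient.mk (simpSetoid A) ⟨m, hm⟩).out.1)) := by
    intro m hm
    exact Quotient.exact (Quotient.out_eq (Quotient.mk (simpSetoid A) ⟨m, hm⟩)).symm
  have hA : ELift A A A := fun Y Z _ _ _ _ q hq _ f => Module.projective_lifting_property q f hq
  obtain ⟨finA, -⟩ := count_le (R := R) A hA (J := ⊥) (fun a => by
      rw [Submodule.mem_bot]
      exact ⟨fun h t => by rw [h, zero_smul], fun h => by simpa using h 1⟩)
    (fun _ : Fin 1 => (1 : A)) (fun a h => by simpa using h 0)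
    (fun c : Quotient (simpSetoid A) => c.out.1) (fun m hm _ => ⟨_, hmk m hm⟩)
  let kill : Quotient (simpSetoid A) → Prop := fun c => ∀ a ∈ J, ∀ y : A ⧸ c.out.1, a • y = 0
  obtain ⟨finT, hle⟩ := count_le (R := R) T hT hJ v hv
    (fun c : {c : Quotient (simpSetoid A) // kill c} => c.1.out.1) (fun m hm hk => by
      obtain ⟨e⟩ := hmk m hm
      refine ⟨⟨Quotient.mk (simpSetoid A) ⟨m, hm⟩, ?_⟩, ⟨e⟩⟩
      intro a ha y
      apply e.symm.injective
      have h := e.symm.map_smul a y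
      rw [h, hk a ha, map_zero])
  obtain ⟨g, hg⟩ := simp_to_cls A
  have h1 := Nat.card_le_card_of_injective g hg
  have h2 : Nat.card (indCls A T) = Nat.card (indCls A A) := hnum
  rw [Nat.card_eq_fintype_card] at h1
  have h3 : Fintype.card (Quotient (simpSetoid A)) ≤
      Fintype.card {c : Quotient (simpSetoid A) // kill c} := by omega
  have hall : ∀ c, kill c := by
    by_contra hne
    push Not at hne
    obtain ⟨c, hc⟩ := hne
    exact absurd (Fintype.card_subtype_lt hc) (not_lt.2 h3)
  rw [Ring.jacobson_eq_sInf_isMaximal]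
  refine le_sInf ?_
  intro m hm a ha
  obtain ⟨e⟩ := hmk m (show m.IsMaximal from hm).out
  have h4 : a • (m.mkQ 1) = 0 := by
    apply e.injective
    have h := e.map_smul a (m.mkQ 1)
    rw [h, hall _ a ha, map_zero]
  rw [← map_smul, Submodule.mkQ_apply, Submodule.Quotient.mk_eq_zero, smul_eq_mul, mul_one] at h4
  exact h4
end TauAux9

section TauAux10

lemma main_aux
    (R A : Type) [CommRing R] [IsArtinianRing R] [Ring A] [Algebra R A] [Module.Finite R A]
    (T : Type) [AddCommGroup T] [Module A T] [Module.Finite A T]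
    (I : TwoSidedIdeal A) (hI : ∀ a : A, a ∈ I ↔ ∀ t : T, a • t = 0)
    (htauRigid : tauRigid A T) (hnum : numIndec A T = numIndec A A)
    (hnotTilting :
      ¬ (pdLeOne A T ∧ Subsingleton (egrp A 1 T T) ∧ numIndec A T = numIndec A A)) :
    Subsingleton (balTensor ℤ A (↥(rIdeal A I)) T) ∧
      ¬ Subsingleton (Tor1 ℤ A (↥(rIdeal A I)) T) := by
  have : IsArtinianRing A := IsArtinianRing.of_finite R A
  let iR : Module R T := Module.compHom T (algebraMap R A)
  have iT : IsScalarTower R A T := ⟨fun r a x => by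
      show (r • a) • x = algebraMap R A r • (a • x)
      rw [Algebra.smul_def, mul_smul]⟩
  have iF : Module.Finite R T := Module.Finite.trans A T
  obtain ⟨J, hJI⟩ : ∃ J : Ideal A, ∀ a, a ∈ J ↔ a ∈ I := ⟨
    { carrier := {a | a ∈ I}
      add_mem' := fun {a b} ha hb => I.add_mem ha hb
      zero_mem' := I.zero_mem
      smul_mem' := fun c x hx => I.mul_mem_left c x hx }, fun a => Iff.rfl⟩
  have hJ : ∀ a, a ∈ J ↔ ∀ t : T, a • t = 0 := fun a => (hJI a).trans (hI a)
  obtain ⟨n, v, hvs⟩ := Module.Finite.exists_fin (R := R) (M := T)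
  have hv : ∀ a : A, (∀ i, a • v i = 0) → a ∈ J := by
    intro a ha
    rw [hJ]
    intro t
    have ht : t ∈ Submodule.span R (Set.range v) := by rw [hvs]; trivial
    induction ht using Submodule.span_induction with
    | mem x hx => obtain ⟨i, rfl⟩ := hx; exact ha i
    | zero => rw [smul_zero]
    | add x y _ _ hx hy => rw [smul_add, hx, hy, add_zero]
    | smul r x _ hx => rw [smul_comm, hx, smul_zero]
  have hT : ELift A T T := elift_of_tauRigid A T htauRigid
  obtain ⟨s, hs⟩ := (Module.Finite.fg_top : (⊤ : Submodule A T).FG)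
  obtain ⟨p, hp, emb, ret, hre⟩ : ∃ p : (s →₀ A) →ₗ[A] T, Function.Surjective p ∧
      ∃ (emb : LinearMap.ker p →ₗ[A] presKer A T) (ret : presKer A T →ₗ[A] LinearMap.ker p),
      ret.comp emb = LinearMap.id := by
    have hp : Function.Surjective (Finsupp.linearCombination A (Subtype.val : s → T)) := by
      rw [← LinearMap.range_eq_top, Finsupp.range_linearCombination, Subtype.range_coe]
      exact hs
    exact ⟨_, hp, emb_ret s hp⟩
  constructor
  · refine tensor_zero (K := ↥(LinearMap.ker p)) I hJI p hp (LinearMap.ker p).subtype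
      (fun k : LinearMap.ker p => k.2)
      (fun a ha => (hJ a).1 ha) (fun f hf hfJ => ?_)
    exact ⟨⟨f, hf⟩, stepb hJ v hv hT p hp ⟨f, hf⟩ hfJ, rfl⟩
  · intro htor
    apply hnotTilting
    refine ⟨?_, htauRigid T (facP.self T), hnum⟩
    have hrad : J ≤ Ring.jacobson A := rad_of_count (R := R) T hT hJ v hv hnum
    have : IsNoetherian A (s →₀ A) := inferInstance
    have hfin : Module.Finite A (LinearMap.ker p) := Module.IsNoetherian.finite A _
    obtain ⟨d, π, hπ⟩ := Module.Finite.exists_fin' A (LinearMap.ker p)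
    have hcrit0 := @tor_crit A _ I T (LinearMap.ker p) (Fin d → A) _ _ J hJI _ _ emb ret
    have hcrit1 := hcrit0 hre
    have hcrit2 := hcrit1 htor
    have hcrit := hcrit2 π hπ
    have hproj : Module.Projective A (LinearMap.ker p) :=
      ker_projective (K := ↥(LinearMap.ker p)) (F := Fin d → A) (J := J) hrad π hπ hcrit
        (fun Y Z _ _ _ _ hk q hq g => lpK hJ v hv hT p hp hk q hq g)
    refine ⟨ModuleCat.of A (s →₀ A), ModuleCat.of A (LinearMap.ker p),
      inferInstanceAs (Module.Projective A (s →₀ A)), hproj, (LinearMap.ker p).subtype, p,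
      Submodule.subtype_injective _, hp, ?_⟩
    exact LinearMap.exact_subtype_ker_map p
end TauAux10

/-- Let `T` be a `τ`-tilting module over an artin algebra `A` that is
not `1`-tilting, and let `I = Ann(T)`.  Then `I ⊗[A] T = 0` but `Tor₁^A(I, T) ≠ 0`. -/
theorem tensor_vanishes_tor_nonzero_of_tauTilting_not_tilting
    (R A : Type) [CommRing R] [IsArtinianRing R] [Ring A] [Algebra R A] [Module.Finite R A]
    (T : Type) [AddCommGroup T] [Module A T] [Module.Finite A T]
    (I : TwoSidedIdeal A) (hI : ∀ a : A, a ∈ I ↔ ∀ t : T, a • t = 0)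
    (htauRigid : tauRigid A T) (hnum : numIndec A T = numIndec A A)
    (hnotTilting :
      ¬ (pdLeOne A T ∧ Subsingleton (egrp A 1 T T) ∧ numIndec A T = numIndec A A)) :
    Subsingleton (balTensor ℤ A (↥(rIdeal A I)) T) ∧
      ¬ Subsingleton (Tor1 ℤ A (↥(rIdeal A I)) T) := by
  exact main_aux R A T I hI htauRigid hnum hnotTilting
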